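/- arXiv:1807.01895 — 12 statements merged into one kernel-verified Lean document; each statement's English description precedes it below -/
import Mathlib

section
/- Let X be a Tychonoff space. If the space USC^f(X), endowed with the topology of pointwise convergence, is sequentially separable, then X has property U. -/
open Filter Topology Set TopologicalSpace

universe u

/-- A zero-set: the preimage of `{0}` under some continuous real-valued function. -/
def IsZeroSet {X : Type u} [TopologicalSpace X] (Z : Set X) : Prop :=
  ∃ g : X → ℝ, Continuous g ∧ Z = g ⁻¹' {0}

/-- A cozero-set: the complement of a zero-set. -/
def IsCozeroSet {X : Type u} [TopologicalSpace X] (U : Set X) : Prop :=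
  IsZeroSet Uᶜ

/-- A Zσ-set: a countable union of zero-sets. -/
def IsZSigmaSet {X : Type u} [TopologicalSpace X] (D : Set X) : Prop :=
  ∃ Z : ℕ → Set X, (∀ n, IsZeroSet (Z n)) ∧ D = ⋃ n, Z n

/-- An Fσ-set: a countable union of closed sets. -/
def IsFSigmaSet {Y : Type u} [TopologicalSpace Y] (S : Set Y) : Prop :=
  ∃ F : ℕ → Set Y, (∀ n, IsClosed (F n)) ∧ S = ⋃ n, F n

/-- `g : ℕ → X → ℝ` converges pointwise to `f : X → ℝ`. -/
def PointwiseLimit {X : Type u} (g : ℕ → X → ℝ) (f : X → ℝ) : Prop :=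
  ∀ x, Tendsto (fun n => g n x) atTop (𝓝 (f x))

/-- `USC^f(X)`: real-valued functions all of whose strict sublevel sets are cozero-sets. -/
def USCf (X : Type u) [TopologicalSpace X] : Set (X → ℝ) :=
  {f | ∀ r : ℝ, IsCozeroSet {x | f x < r}}

/-- `USC(X)`: upper semicontinuous real-valued functions (strict sublevel sets open). -/
def USC (X : Type u) [TopologicalSpace X] : Set (X → ℝ) :=
  {f | ∀ r : ℝ, IsOpen {x | f x < r}}

/-- `B₁(X)`: Baire class one functions, i.e. pointwise limits of sequences of
continuous real-valued functions. -/
def B1 (X : Type u) [TopologicalSpace X] : Set (X → ℝ) :=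
  {f | ∃ g : ℕ → X → ℝ, (∀ n, Continuous (g n)) ∧ PointwiseLimit g f}

/-- A family `F` of real-valued functions on `X` is sequentially separable (for the
topology of pointwise convergence): there is a countable `S ⊆ F` such that every
member of `F` is a pointwise limit of a sequence from `S`. -/
def SeqSeparable {X : Type u} (F : Set (X → ℝ)) : Prop :=
  ∃ S : Set (X → ℝ), S ⊆ F ∧ S.Countable ∧
    ∀ f ∈ F, ∃ g : ℕ → X → ℝ, (∀ n, g n ∈ S) ∧ PointwiseLimit g f

/-- Property `U`: there is a continuous bijection (condensation) from `X` onto a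
separable metrizable space `Y` carrying every zero-set of `X` to an Fσ-set of `Y`. -/
def PropertyU (X : Type u) [TopologicalSpace X] : Prop :=
  ∃ (Y : Type u) (_ : TopologicalSpace Y), MetrizableSpace Y ∧ SeparableSpace Y ∧
    ∃ f : X → Y, Continuous f ∧ Function.Bijective f ∧
      ∀ D : Set X, IsZeroSet D → IsFSigmaSet (f '' D)

theorem isZeroSet_empty {X : Type u} [TopologicalSpace X] : IsZeroSet (∅ : Set X) :=
  ⟨fun _ => 1, continuous_const, by ext; simp⟩

theorem isZeroSet_univ {X : Type u} [TopologicalSpace X] : IsZeroSet (univ : Set X) :=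
  ⟨fun _ => 0, continuous_const, by ext; simp⟩

/-- The indicator function of a zero-set lies in `USC^f(X)`. -/
theorem IsZeroSet.indicator_mem_USCf {X : Type u} [TopologicalSpace X] {D : Set X}
    (hD : IsZeroSet D) : D.indicator (fun _ => (1 : ℝ)) ∈ USCf X := by
  classical
  intro r
  change IsZeroSet {x | D.indicator (fun _ => (1 : ℝ)) x < r}ᶜ
  rcases le_or_gt r 0 with h0 | h0
  · convert isZeroSet_univ (X := X)
    ext x
    by_cases hx : x ∈ D <;> simp [hx] <;> linarith
  · rcases le_or_gt r 1 with h1 | h1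
    · convert hD
      ext x
      by_cases hx : x ∈ D <;> simp [hx] <;> linarith
    · convert isZeroSet_empty (X := X)
      ext x
      by_cases hx : x ∈ D <;> simp [hx] <;> linarith

/-- A point lies in `D` iff functions converging pointwise to the indicator of `D` are
eventually at least `1 / 2` there. -/
theorem PointwiseLimit.mem_iff_eventually {X : Type u} {D : Set X} {g : ℕ → X → ℝ}
    (hg : PointwiseLimit g (D.indicator fun _ => (1 : ℝ))) (x : X) :
    x ∈ D ↔ ∀ᶠ k in atTop, ¬ g k x < 1 / 2 := by
  classical
  have hx := hg x
  constructor
  · intro h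
    rw [indicator_of_mem h] at hx
    filter_upwards [hx.eventually (lt_mem_nhds (by norm_num : (1 / 2 : ℝ) < 1))] with k hk
    exact hk.not_gt
  · intro h
    by_contra hD
    rw [indicator_of_notMem hD] at hx
    obtain ⟨k, hk, hk'⟩ :=
      (h.and (hx.eventually (gt_mem_nhds (by norm_num : (0 : ℝ) < 1 / 2)))).exists
    exact hk hk'

/-- Distinct points of a Tychonoff space are separated by a zero-set. -/
theorem exists_isZeroSet_mem_notMem {X : Type u} [TopologicalSpace X] [T2Space X]
    [CompletelyRegularSpace X] {x y : X} (hxy : x ≠ y) :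
    ∃ D : Set X, IsZeroSet D ∧ x ∈ D ∧ y ∉ D := by
  obtain ⟨f, hf, hfx, hfy⟩ :=
    CompletelyRegularSpace.completely_regular x {y} isClosed_singleton (by simpa using hxy)
  refine ⟨(fun z => (f z : ℝ)) ⁻¹' {0}, ⟨_, by fun_prop, rfl⟩, by simp [hfx], ?_⟩
  have : f y = 1 := hfy rfl
  simp [this]

/-- If `USC^f(X)` is sequentially separable for a Tychonoff space `X`, then `X ⊨ U`. -/
theorem stmt0 (X : Type u) [TopologicalSpace X] [T2Space X] [CompletelyRegularSpace X]
    (h : SeqSeparable (USCf X)) : PropertyU X := by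
  obtain ⟨S, hS, hSc, hlim⟩ := h
  have : Countable S := hSc.to_subtype
  have hzero : ∀ f : S, ∃ g : X → ℝ, Continuous g ∧ ∀ x, g x = 0 ↔ ¬ f.1 x < 1 / 2 := by
    intro f
    obtain ⟨g, hg, hfg⟩ := hS f.2 (1 / 2)
    exact ⟨g, hg, fun x => (Set.ext_iff.1 hfg x).symm⟩
  choose φ hφ hφ0 using hzero
  let H : X → S → ℝ := fun x f => φ f x
  have key : ∀ D : Set X, IsZeroSet D →
      ∃ s : ℕ → S, ∀ x, x ∈ D ↔ ∀ᶠ k in atTop, H x (s k) = 0 := by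
    intro D hD
    obtain ⟨g, hgS, hg⟩ := hlim _ hD.indicator_mem_USCf
    refine ⟨fun k => ⟨g k, hgS k⟩, fun x => ?_⟩
    simp only [H, hφ0]
    exact hg.mem_iff_eventually x
  have hinj : Function.Injective H := by
    intro x y hxy
    by_contra hne
    obtain ⟨D, hD, hx, hy⟩ := exists_isZeroSet_mem_notMem hne
    obtain ⟨s, hs⟩ := key D hD
    rw [hs, ← hxy, ← hs] at hy
    exact hy hx
  have hcont : Continuous H := continuous_pi hφ
  refine ⟨range H, inferInstance, inferInstance, inferInstance, rangeFactorization H,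
    hcont.subtype_mk _, ⟨fun x y hxy => hinj (congrArg Subtype.val hxy),
      rangeFactorization_surjective⟩, fun D hD => ?_⟩
  obtain ⟨s, hs⟩ := key D hD
  refine ⟨fun N => ⋂ k ≥ N, {y | y.1 (s k) = 0}, fun N => ?_, ?_⟩
  · exact isClosed_biInter fun k _ => isClosed_eq ((continuous_apply _).comp continuous_subtype_val)
      continuous_const
  · ext ⟨_, x, rfl⟩
    have himage : (⟨H x, x, rfl⟩ : range H) ∈ rangeFactorization H '' D ↔ x ∈ D := by
      constructor
      · rintro ⟨z, hz, hzx⟩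
        exact hinj (congrArg Subtype.val hzx) ▸ hz
      · exact fun hx => ⟨x, hx, rfl⟩
    rw [himage, hs, eventually_atTop]
    simp
end

section
/- Let X be a Tychonoff space. If X has property U, then the space USC^f(X), endowed with the topology of pointwise convergence, is sequentially separable. -/
open Filter Topology Set TopologicalSpace

universe u

open scoped ENNReal

/-- For countably many closed sets `E i` there is a finite function `Φ` which detects them: if
`u n → x` and `Φ (u n)` asymptotically does not exceed `Φ x`, then `u` eventually belongs to every
`E i` containing `x`. -/
theorem exists_forall_eventually_mem_of_isClosed {Y ι : Type*} [TopologicalSpace Y] [Countable ι]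
    (E : ι → Set Y) (hE : ∀ i, IsClosed (E i)) :
    ∃ Φ : Y → ℝ≥0∞, (∀ y, Φ y ≠ ∞) ∧ ∀ (x : Y) (u : ℕ → Y) (ε : ℕ → ℝ≥0∞),
      Tendsto u atTop (𝓝 x) → Tendsto ε atTop (𝓝 0) → (∀ n, Φ (u n) ≤ Φ x + ε n) →
      ∀ i, x ∈ E i → ∀ᶠ n in atTop, u n ∈ E i := by
  classical
  obtain ⟨w, hw0, hw⟩ := ENNReal.exists_pos_sum_of_countable one_ne_zero ι
  set F : ι → Y → ℝ≥0∞ := fun i => (E i)ᶜ.indicator fun _ => (w i : ℝ≥0∞) with hF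
  have hFlsc : ∀ i, LowerSemicontinuous (F i) := fun i =>
    (hE i).isOpen_compl.lowerSemicontinuous_indicator zero_le
  have hFin : ∀ y, ∑' i, F i y ≠ ∞ := fun y => by
    refine ((ENNReal.tsum_le_tsum fun i => ?_).trans_lt (hw.trans ENNReal.one_lt_top)).ne
    exact indicator_le_self' (fun _ _ => zero_le) y
  refine ⟨fun y => ∑' i, F i y, hFin, fun x u ε hu hε hle i hi => ?_⟩
  set G : Y → ℝ≥0∞ := fun y => ∑' j, if j = i then 0 else F j y with hG
  have hsplit : ∀ y, ∑' j, F j y = F i y + G y := fun y => ENNReal.tsum_eq_add_tsum_ite i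
  have hGlsc : LowerSemicontinuous G := by
    refine lowerSemicontinuous_tsum fun j => ?_
    by_cases hj : j = i
    · simpa [hj] using lowerSemicontinuous_const
    · simpa [hj] using hFlsc j
  have hFx : F i x = 0 := by simp [hF, hi]
  have hGx : G x ≠ ∞ := by simpa [hsplit, hFx] using hFin x
  have hw2 : (w i : ℝ≥0∞) / 2 ≠ 0 := by simpa using (hw0 i).ne'
  have hGev : ∀ᶠ n in atTop, G x ≤ G (u n) + w i / 2 := by
    by_cases h0 : G x = 0
    · simp [h0]
    · filter_upwards [hu.eventually (hGlsc x _ (ENNReal.sub_lt_self hGx h0 hw2))] with n hn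
      exact tsub_le_iff_right.1 hn.le
  filter_upwards [hGev, hε.eventually_lt_const (pos_iff_ne_zero.2 hw2)] with n hn hεn
  by_contra hmem
  have h1 := hle n
  have hFu : F i (u n) = w i := by simp [hF, hmem]
  simp only [hsplit, hFx, hFu, zero_add] at h1
  have hGu : G (u n) ≠ ∞ := by
    have := hFin (u n)
    rw [hsplit] at this
    exact (ENNReal.add_ne_top.1 this).2
  have h2 : (w i : ℝ≥0∞) + G (u n) < w i + G (u n) :=
    calc (w i : ℝ≥0∞) + G (u n) ≤ G x + ε n := h1
      _ < G x + w i / 2 := (ENNReal.add_lt_add_iff_left hGx).2 hεn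
      _ ≤ G (u n) + w i / 2 + w i / 2 := by gcongr
      _ = w i + G (u n) := by rw [add_assoc, ENNReal.add_halves, add_comm]
  exact h2.false

/-- A separable metrizable space has a sequence of finite open covers that shrink to every point. -/
theorem exists_finite_open_covers_shrinking (Y : Type*) [TopologicalSpace Y] [MetrizableSpace Y]
    [SeparableSpace Y] :
    ∃ 𝒰 : ℕ → Set (Set Y), (∀ k, (𝒰 k).Finite) ∧ (∀ k, ∀ U ∈ 𝒰 k, IsOpen U) ∧
      (∀ k x, ∃ U ∈ 𝒰 k, x ∈ U) ∧
      ∀ x, ∀ V ∈ 𝓝 x, ∀ᶠ k in atTop, ∀ U ∈ 𝒰 k, x ∈ U → U ⊆ V := by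
  let _ := metrizableSpaceMetric Y
  obtain ⟨e, he⟩ := Metric.PiNatEmbed.exists_embedding_to_hilbert_cube (X := Y)
  let _ := metrizableSpaceMetric (ℕ → unitInterval)
  have hpos : ∀ k : ℕ, (0 : ℝ) < 1 / (k + 1) := fun k => Nat.one_div_pos_of_nat
  choose t _ htfin htcov using fun k : ℕ =>
    finite_cover_balls_of_compact (isCompact_univ (X := ℕ → unitInterval)) (hpos k)
  refine ⟨fun k => (fun c => e ⁻¹' Metric.ball c (1 / (k + 1))) '' t k,
    fun k => (htfin k).image _, ?_, fun k x => ?_, fun x V hV => ?_⟩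
  · rintro k _ ⟨c, -, rfl⟩
    exact Metric.isOpen_ball.preimage he.continuous
  · obtain ⟨c, hc, hxc⟩ := mem_iUnion₂.1 (htcov k (mem_univ (e x)))
    exact ⟨_, mem_image_of_mem _ hc, hxc⟩
  · rw [he.isInducing.nhds_eq_comap, mem_comap] at hV
    obtain ⟨W, hW, hWV⟩ := hV
    obtain ⟨ε, hε, hεW⟩ := Metric.mem_nhds_iff.1 hW
    filter_upwards [(tendsto_one_div_add_atTop_nhds_zero_nat (𝕜 := ℝ)).eventually_lt_const
      (half_pos hε)] with k hk
    rintro _ ⟨c, -, rfl⟩ hx y hy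
    refine hWV (hεW ?_)
    have h1 : dist (e x) c < 1 / (k + 1) := hx
    have h2 : dist (e y) c < 1 / (k + 1) := hy
    have h3 := dist_triangle_right (e y) (e x) c
    exact Metric.mem_ball.2 (by linarith)

/-- The minimum of the values `c U` over the members `U` of a cover that contain `x`. -/
noncomputable def coverMin {Y : Type*} (𝒱 : Set (Set Y)) (c : 𝒱 → ℚ) (x : Y) : ℝ :=
  ⨅ U : {U : 𝒱 // x ∈ U.1}, (c U : ℝ)

theorem exists_coverMin_eq {Y : Type*} {𝒱 : Set (Set Y)} (hfin : 𝒱.Finite) (c : 𝒱 → ℚ) {x : Y}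
    (hx : ∃ U ∈ 𝒱, x ∈ U) : ∃ U : 𝒱, x ∈ U.1 ∧ coverMin 𝒱 c x = c U := by
  obtain ⟨V, hV, hxV⟩ := hx
  have := hfin.to_subtype
  have : Nonempty {U : 𝒱 // x ∈ U.1} := ⟨⟨⟨V, hV⟩, hxV⟩⟩
  obtain ⟨U, hU⟩ := exists_eq_ciInf_of_finite (f := fun U : {U : 𝒱 // x ∈ U.1} => (c U : ℝ))
  exact ⟨U, U.2, hU.symm⟩

theorem isOpen_coverMin_lt {Y : Type*} [TopologicalSpace Y] {𝒱 : Set (Set Y)} (hfin : 𝒱.Finite)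
    (hopen : ∀ U ∈ 𝒱, IsOpen U) (hcov : ∀ x, ∃ U ∈ 𝒱, x ∈ U) (c : 𝒱 → ℚ) (r : ℝ) :
    IsOpen {x | coverMin 𝒱 c x < r} := by
  have := hfin.to_subtype
  refine isOpen_iff_mem_nhds.2 fun x hx => ?_
  obtain ⟨U, hxU, hU⟩ := exists_coverMin_eq hfin c (hcov x)
  filter_upwards [(hopen U U.2).mem_nhds hxU] with y hy
  refine (ciInf_le (finite_range _).bddBelow (⟨U, hy⟩ : {U : 𝒱 // y ∈ U.1})).trans_lt ?_
  exact hU ▸ hx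

/-- If all the sets `{f < q}` and `{q < f}` are Fσ, convergence to `f x` along a sequence is
controlled by countably many closed sets. -/
theorem exists_closed_detecting {Y : Type u} [TopologicalSpace Y] {f : Y → ℝ}
    (hlt : ∀ r, IsFSigmaSet {y | f y < r}) (hgt : ∀ r, IsFSigmaSet {y | r < f y}) :
    ∃ E : (ℚ × ℕ) ⊕ (ℚ × ℕ) → Set Y, (∀ i, IsClosed (E i)) ∧ ∀ (x : Y) (u : ℕ → Y),
      (∀ i, x ∈ E i → ∀ᶠ n in atTop, u n ∈ E i) → Tendsto (f ∘ u) atTop (𝓝 (f x)) := by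
  choose A hA hAeq using hlt
  choose B hB hBeq using hgt
  have hAmem : ∀ r y, f y < r ↔ ∃ n, y ∈ A r n := fun r y => by
    rw [← mem_iUnion, ← hAeq, mem_ofPred_eq]
  have hBmem : ∀ r y, r < f y ↔ ∃ n, y ∈ B r n := fun r y => by
    rw [← mem_iUnion, ← hBeq, mem_ofPred_eq]
  refine ⟨Sum.elim (fun p => A p.1 p.2) (fun p => B p.1 p.2), ?_, fun x u hu => ?_⟩
  · rintro (p | p)
    · exact hA _ _
    · exact hB _ _
  · refine tendsto_order.2 ⟨fun a ha => ?_, fun a ha => ?_⟩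
    · obtain ⟨q, haq, hq⟩ := exists_rat_btwn ha
      obtain ⟨n, hn⟩ := (hBmem _ _).1 hq
      filter_upwards [hu (Sum.inr (q, n)) hn] with m hm
      exact haq.trans ((hBmem _ _).2 ⟨n, hm⟩)
    · obtain ⟨q, hq, hqa⟩ := exists_rat_btwn ha
      obtain ⟨n, hn⟩ := (hAmem _ _).1 hq
      filter_upwards [hu (Sum.inl (q, n)) hn] with m hm
      exact ((hAmem _ _).2 ⟨n, hm⟩).trans hqa

/-- On a separable metrizable space there is a countable set of upper semicontinuous functions
such that every function of the first Borel class is the limit of a sequence from it. -/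
theorem exists_countable_usc_seqDense (Y : Type u) [TopologicalSpace Y] [MetrizableSpace Y]
    [SeparableSpace Y] :
    ∃ S : Set (Y → ℝ), S ⊆ USC Y ∧ S.Countable ∧ ∀ f : Y → ℝ,
      (∀ r, IsFSigmaSet {y | f y < r}) → (∀ r, IsFSigmaSet {y | r < f y}) →
      ∃ g : ℕ → Y → ℝ, (∀ n, g n ∈ S) ∧ PointwiseLimit g f := by
  obtain ⟨𝒰, hfin, hopen, hcov, hshrink⟩ := exists_finite_open_covers_shrinking Y
  refine ⟨⋃ k, range (coverMin (𝒰 k)), ?_, ?_, fun f hlt hgt => ?_⟩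
  · refine iUnion_subset fun k => ?_
    rintro _ ⟨c, rfl⟩ r
    exact isOpen_coverMin_lt (hfin k) (hopen k) (hcov k) c r
  · refine countable_iUnion fun k => ?_
    have := (hfin k).to_subtype
    exact countable_range _
  obtain ⟨E, hE, hdet⟩ := exists_closed_detecting hlt hgt
  obtain ⟨Φ, hΦ, hΦE⟩ := exists_forall_eventually_mem_of_isClosed E hE
  have hval : ∀ (k : ℕ) (U : Set Y), ∃ c : ℚ, U.Nonempty → ∃ y ∈ U,
      (∀ x ∈ U, Φ y ≤ Φ x + (k : ℝ≥0∞)⁻¹) ∧ f y < c ∧ c < f y + 1 / ((k : ℝ) + 1) := fun k U => by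
    rcases U.eq_empty_or_nonempty with rfl | ⟨z, hz⟩
    · exact ⟨0, fun h => (not_nonempty_empty h).elim⟩
    have hinf : ⨅ x ∈ U, Φ x ≠ ∞ := ((iInf₂_le z hz).trans_lt (hΦ z).lt_top).ne
    have hlt := ENNReal.lt_add_right hinf (ENNReal.inv_ne_zero.2 (ENNReal.natCast_ne_top k))
    simp only [iInf_lt_iff] at hlt
    obtain ⟨y, hyU, hy⟩ := hlt
    obtain ⟨c, hc⟩ := exists_rat_btwn
      (lt_add_of_pos_right (f y) (Nat.one_div_pos_of_nat (α := ℝ) (n := k)))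
    exact ⟨c, fun _ => ⟨y, hyU, fun x hx => hy.le.trans (by gcongr; exact iInf₂_le x hx), hc⟩⟩
  choose c hc using hval
  refine ⟨fun k => coverMin (𝒰 k) fun U => c k U, fun k => mem_iUnion.2 ⟨k, mem_range_self _⟩,
    fun x => ?_⟩
  choose V hxV hV using fun k => exists_coverMin_eq (hfin k) (fun U => c k U) (hcov k x)
  choose u huV hΦu hcgt hclt using fun k => hc k (V k) ⟨x, hxV k⟩
  have hu : Tendsto u atTop (𝓝 x) :=
    tendsto_def.2 fun W hW => by
      filter_upwards [hshrink x W hW] with k hk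
      exact hk _ (V k).2 (hxV k) (huV k)
  have hf : Tendsto (fun k => f (u k)) atTop (𝓝 (f x)) :=
    hdet x _ (hΦE x _ _ hu ENNReal.tendsto_inv_nat_nhds_zero fun k => hΦu k x (hxV k))
  have hf' : Tendsto (fun k : ℕ => f (u k) + 1 / ((k : ℝ) + 1)) atTop (𝓝 (f x)) := by
    simpa using hf.add tendsto_one_div_add_atTop_nhds_zero_nat
  simp only [hV]
  exact tendsto_of_tendsto_of_tendsto_of_le_of_le hf hf' (fun k => (hcgt k).le)
    fun k => (hclt k).le

theorem IsFSigmaSet.iUnion {Y : Type u} [TopologicalSpace Y] {s : ℕ → Set Y}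
    (hs : ∀ n, IsFSigmaSet (s n)) : IsFSigmaSet (⋃ n, s n) := by
  choose F hF hFs using hs
  refine ⟨fun m => F m.unpair.1 m.unpair.2, fun m => hF _ _, ?_⟩
  rw [iUnion_unpair F]
  exact iUnion_congr hFs

theorem IsCozeroSet.isZSigmaSet {X : Type u} [TopologicalSpace X] {U : Set X}
    (hU : IsCozeroSet U) : IsZSigmaSet U := by
  obtain ⟨g, hg, hUg⟩ := hU
  refine ⟨fun n => {x | 1 / ((n : ℝ) + 1) ≤ |g x|}, fun n =>
    ⟨fun x => min (|g x| - 1 / ((n : ℝ) + 1)) 0, by fun_prop, ?_⟩, ?_⟩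
  · ext x
    simp
  · ext x
    have hx : x ∈ U ↔ 0 < |g x| := by
      rw [← not_iff_not, ← mem_compl_iff, hUg]
      simp
    simp only [hx, mem_iUnion, mem_ofPred_eq]
    exact ⟨fun h => (exists_nat_one_div_lt h).imp fun _ => le_of_lt,
      fun ⟨n, hn⟩ => Nat.one_div_pos_of_nat.trans_le hn⟩

theorem IsOpen.isCozeroSet {Y : Type u} [TopologicalSpace Y] [MetrizableSpace Y] {U : Set Y}
    (hU : IsOpen U) : IsCozeroSet U := by
  let _ := metrizableSpaceMetric Y
  rcases Uᶜ.eq_empty_or_nonempty with h | h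
  · exact ⟨fun _ => 1, continuous_const, by simp [h]⟩
  · exact ⟨fun y => Metric.infDist y Uᶜ, Metric.continuous_infDist_pt _,
      Set.ext fun y => hU.isClosed_compl.mem_iff_infDist_zero h⟩

theorem IsCozeroSet.preimage {X Y : Type u} [TopologicalSpace X] [TopologicalSpace Y] {U : Set Y}
    (hU : IsCozeroSet U) {φ : X → Y} (hφ : Continuous φ) : IsCozeroSet (φ ⁻¹' U) := by
  obtain ⟨g, hg, hUg⟩ := hU
  exact ⟨g ∘ φ, hg.comp hφ, by rw [← preimage_compl, hUg]; rfl⟩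

/-- If a Tychonoff space `X` has property `U`, then `USC^f(X)` is sequentially separable. -/
theorem stmt1 (X : Type u) [TopologicalSpace X] [T2Space X] [CompletelyRegularSpace X]
    (h : PropertyU X) : SeqSeparable (USCf X) := by
  obtain ⟨Y, _, _, _, φ, hφ, hbij, hD⟩ := h
  obtain ⟨S, hSU, hS, hlim⟩ := exists_countable_usc_seqDense Y
  refine ⟨(fun s => s ∘ φ) '' S, ?_, hS.image _, fun f hf => ?_⟩
  · rintro _ ⟨s, hs, rfl⟩ r
    exact (hSU hs r).isCozeroSet.preimage hφ
  obtain ⟨ψ, hψφ, hφψ⟩ := Function.bijective_iff_has_inverse.1 hbij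
  have himage : ∀ A : Set X, φ '' A = ψ ⁻¹' A := fun A =>
    congrFun (image_eq_preimage_of_inverse hψφ hφψ) A
  suffices h : (∀ r, IsFSigmaSet {y | (f ∘ ψ) y < r}) ∧ ∀ r, IsFSigmaSet {y | r < (f ∘ ψ) y} by
    obtain ⟨g, hgS, hg⟩ := hlim (f ∘ ψ) h.1 h.2
    refine ⟨fun n => g n ∘ φ, fun n => mem_image_of_mem _ (hgS n), fun x => ?_⟩
    simpa [hψφ x] using hg (φ x)
  refine ⟨fun r => ?_, fun r => ?_⟩
  · obtain ⟨Z, hZ, hZeq⟩ := (hf r).isZSigmaSet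
    have : {y | (f ∘ ψ) y < r} = ⋃ n, φ '' Z n := by
      rw [← image_iUnion, ← hZeq, himage]
      rfl
    exact this ▸ IsFSigmaSet.iUnion fun n => hD _ (hZ n)
  · have : {y | r < (f ∘ ψ) y} = ⋃ n : ℕ, φ '' {x | f x < r + 1 / ((n : ℝ) + 1)}ᶜ := by
      ext y
      simp only [himage, mem_ofPred_eq, mem_iUnion, mem_preimage, mem_compl_iff, not_lt,
        Function.comp_apply]
      refine ⟨fun h => ?_, fun ⟨n, hn⟩ =>
        (lt_add_of_pos_right r Nat.one_div_pos_of_nat).trans_le hn⟩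
      obtain ⟨n, hn⟩ := exists_nat_one_div_lt (sub_pos.2 h)
      exact ⟨n, by linarith⟩
    exact this ▸ IsFSigmaSet.iUnion fun n => hD _ (hf _)
end

section
/- Let X be a Tychonoff space. If there exists a countable set S of continuous real-valued functions on X such that every function in B₁(X) is the pointwise limit of a sequence of elements of S, then X has property U. -/
open Filter Topology Set TopologicalSpace

universe u

/-- The indicator function of a zero-set is of Baire class one. -/
theorem IsZeroSet.indicator_one_mem_B1 {X : Type u} [TopologicalSpace X] {D : Set X}
    (hD : IsZeroSet D) : D.indicator (fun _ => (1 : ℝ)) ∈ B1 X := by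
  obtain ⟨g, hg, rfl⟩ := hD
  refine ⟨fun n x => max 0 (1 - n * |g x|), fun n => by fun_prop, fun x => ?_⟩
  by_cases hx : g x = 0
  · simp [indicator, hx]
  · have hlim : Tendsto (fun n : ℕ => (n : ℝ) * |g x|) atTop atTop :=
      tendsto_natCast_atTop_atTop.atTop_mul_const (abs_pos.mpr hx)
    refine tendsto_const_nhds.congr' ?_
    filter_upwards [hlim.eventually_ge_atTop 1] with n hn
    simp [indicator, hx, hn]

/-- A continuous function is of Baire class one. -/
theorem Continuous.mem_B1 {X : Type u} [TopologicalSpace X] {f : X → ℝ} (hf : Continuous f) :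
    f ∈ B1 X :=
  ⟨fun _ => f, fun _ => hf, fun _ => tendsto_const_nhds⟩

/-- A set whose indicator function is a pointwise limit of continuous functions is an Fσ-set. -/
theorem isFSigmaSet_of_tendsto_indicator_one {Y : Type u} [TopologicalSpace Y] {D : Set Y}
    {g : ℕ → Y → ℝ} (hg : ∀ n, Continuous (g n))
    (hlim : PointwiseLimit g (D.indicator fun _ => 1)) : IsFSigmaSet D := by
  refine ⟨fun N => ⋂ n ≥ N, {y | 1 / 2 ≤ g n y}, fun N => isClosed_biInter fun n _ =>
    isClosed_le continuous_const (hg n), ?_⟩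
  ext y
  simp only [mem_iUnion, mem_iInter, mem_ofPred_eq]
  have hy := hlim y
  constructor
  · intro hD
    rw [indicator_of_mem hD] at hy
    exact eventually_atTop.mp (hy.eventually_const_le (by norm_num))
  · rintro ⟨N, hN⟩
    by_contra hD
    rw [indicator_of_notMem hD] at hy
    have := ge_of_tendsto hy (eventually_atTop.mpr ⟨N, hN⟩)
    norm_num at this

/-- If there is a countable set `S` of continuous functions on a Tychonoff space `X` with
`[S]_seq = B₁(X)`, then `X ⊨ U`. -/
theorem stmt2 (X : Type u) [TopologicalSpace X] [T2Space X] [CompletelyRegularSpace X]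
    (h : ∃ S : Set (X → ℝ), S.Countable ∧ (∀ f ∈ S, Continuous f) ∧
      ∀ f ∈ B1 X, ∃ g : ℕ → X → ℝ, (∀ n, g n ∈ S) ∧ PointwiseLimit g f) :
    PropertyU X := by
  obtain ⟨S, hScount, hScont, hS⟩ := h
  have : Countable S := hScount.to_subtype
  let e : X → S → ℝ := fun x s => s.1 x
  have he : Continuous e := continuous_pi fun s => hScont s.1 s.2
  have hinj : Function.Injective e := by
    intro x y hxy
    by_contra hne
    obtain ⟨f, hf, hfx, hfy⟩ := CompletelyRegularSpace.completely_regular x {y}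
      isClosed_singleton hne
    obtain ⟨g, hgS, hg⟩ := hS (fun z => (f z : ℝ)) (continuous_subtype_val.comp hf).mem_B1
    have hgxy : ∀ n, g n x = g n y := fun n => congrFun hxy ⟨g n, hgS n⟩
    have hlim := hg x
    simp only [hgxy] at hlim
    have heq := tendsto_nhds_unique hlim (hg y)
    simp [hfx, hfy rfl] at heq
  refine ⟨range e, inferInstance, inferInstance, inferInstance, rangeFactorization e,
    he.subtype_mk _, ⟨rangeFactorization_injective.mpr hinj, rangeFactorization_surjective⟩,
    fun D hD => ?_⟩
  obtain ⟨g, hgS, hg⟩ := hS _ hD.indicator_one_mem_B1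
  refine isFSigmaSet_of_tendsto_indicator_one
    (g := fun n y => y.1 ⟨g n, hgS n⟩) (fun n => (continuous_apply (⟨g n, hgS n⟩ : S)).comp continuous_subtype_val) ?_
  rintro ⟨_, x, rfl⟩
  have hmem : (⟨e x, x, rfl⟩ : range e) ∈ rangeFactorization e '' D ↔ x ∈ D :=
    (rangeFactorization_injective.mpr hinj).mem_set_image
  have hind : (rangeFactorization e '' D).indicator (fun _ => (1 : ℝ)) ⟨e x, x, rfl⟩ =
      D.indicator (fun _ => 1) x := by
    by_cases hx : x ∈ D
    · rw [indicator_of_mem hx, indicator_of_mem (hmem.mpr hx)]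
    · rw [indicator_of_notMem hx, indicator_of_notMem (mt hmem.mp hx)]
  rw [hind]
  exact hg x
end

section
/- Let X be a Tychonoff space. If X has property U, then there exists a countable set S of continuous real-valued functions on X such that every function in B₁(X) is the pointwise limit of a sequence of elements of S. -/
open Filter Topology Set TopologicalSpace

universe u

/-- Every closed subset of a metrizable space is a zero-set. -/
theorem IsClosed.isZeroSet {X : Type u} [TopologicalSpace X] [MetrizableSpace X] {C : Set X}
    (hC : IsClosed C) : IsZeroSet C := by
  let := metrizableSpaceMetric X
  rcases C.eq_empty_or_nonempty with rfl | hne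
  · exact ⟨fun _ => 1, continuous_const, by ext; simp⟩
  · refine ⟨fun x => Metric.infDist x C, Metric.continuous_infDist_pt C, ?_⟩
    ext x
    simp [hC.mem_iff_infDist_zero hne]

theorem IsZeroSet.preimage {X : Type u} {Y : Type*} [TopologicalSpace X] [TopologicalSpace Y]
    [MetrizableSpace Y] {C : Set Y} (hC : IsClosed C) {f : X → Y} (hf : Continuous f) :
    IsZeroSet (f ⁻¹' C) := by
  obtain ⟨g, hg, rfl⟩ := hC.isZeroSet
  exact ⟨g ∘ f, hg.comp hf, rfl⟩

/-- The indicator of a closed subset of a metrizable space is a pointwise eventually constant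
limit of continuous functions that are equal to `1` on the set. -/
theorem exists_continuousMap_eventually_eq_indicator {K : Type*} [TopologicalSpace K]
    [MetrizableSpace K] {C : Set K} (hC : IsClosed C) :
    ∃ u : ℕ → C(K, ℝ), (∀ n, ∀ x ∈ C, u n x = 1) ∧ ∀ x ∉ C, ∀ᶠ n in atTop, u n x = 0 := by
  obtain ⟨g, hg, rfl⟩ := hC.isZeroSet
  refine ⟨fun n => ⟨fun x => max 0 (1 - n * |g x|), by fun_prop⟩, fun n x hx => ?_,
    fun x hx => ?_⟩
  · have : g x = 0 := hx
    simp [this]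
  · have hpos : 0 < |g x| := abs_pos.2 hx
    obtain ⟨N, hN⟩ := exists_nat_ge (1 / |g x|)
    filter_upwards [eventually_ge_atTop N] with n hn
    have h1 : 1 ≤ (N : ℝ) * |g x| := (div_le_iff₀ hpos).1 hN
    have h2 : (N : ℝ) * |g x| ≤ n * |g x| := by gcongr
    exact max_eq_left (by linarith)

/-- Given a sequence of closed sets with prescribed values, there are continuous functions which
at each covered point are eventually equal to the value of some closed set containing it. -/
theorem exists_continuousMap_eventually_eq_of_closed_cover {K : Type*} [TopologicalSpace K]
    [MetrizableSpace K] {E : ℕ → Set K} (hE : ∀ k, IsClosed (E k)) (c : ℕ → ℝ) :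
    ∃ s : ℕ → C(K, ℝ), ∀ x ∈ ⋃ k, E k, ∃ k, x ∈ E k ∧ ∀ᶠ n in atTop, s n x = c k := by
  classical
  choose u hu1 hu0 using fun k => exists_continuousMap_eventually_eq_indicator (hE k)
  refine ⟨fun n => ∑ k ∈ Finset.range n,
    c k • (u k n * ∏ i ∈ Finset.range k, (1 - u i n)), fun x hx => ?_⟩
  have hx : ∃ k, x ∈ E k := mem_iUnion.1 hx
  refine ⟨Nat.find hx, Nat.find_spec hx, ?_⟩
  have hev : ∀ᶠ n in atTop, ∀ i ∈ Finset.range (Nat.find hx), u i n x = 0 :=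
    (Filter.eventually_all_finset _).2 fun i hi =>
      hu0 i x (Nat.find_min hx (Finset.mem_range.1 hi))
  filter_upwards [hev, eventually_gt_atTop (Nat.find hx)] with n hn hlt
  simp only [ContinuousMap.sum_apply, ContinuousMap.smul_apply, ContinuousMap.mul_apply,
    ContinuousMap.prod_apply, ContinuousMap.sub_apply, ContinuousMap.one_apply, smul_eq_mul]
  rw [Finset.sum_eq_single_of_mem (Nat.find hx) (Finset.mem_range.2 hlt)]
  · rw [hu1 _ n x (Nat.find_spec hx), Finset.prod_eq_one fun i hi => by rw [hn i hi, sub_zero]]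
    simp
  · intro k _ hk
    rcases lt_or_gt_of_ne hk with h | h
    · rw [hn k (Finset.mem_range.2 h)]
      simp
    · rw [Finset.prod_eq_zero (Finset.mem_range.2 h)
        (by rw [hu1 _ n x (Nat.find_spec hx), sub_self])]
      simp

/-- A uniform limit (with a geometric rate) of pointwise eventually constant limits of continuous
functions on `K` is a pointwise limit of continuous functions on `K`. -/
theorem exists_continuousMap_tendsto_of_geometric {X K : Type*} [TopologicalSpace K] (ι : X → K)
    {h : X → ℝ} {φ : ℕ → X → ℝ} (hφ : ∀ m x, |φ m x - h x| ≤ (1 / 2) ^ m)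
    {s : ℕ → ℕ → C(K, ℝ)} (hs : ∀ m x, ∀ᶠ n in atTop, s m n (ι x) = φ m x) :
    ∃ t : ℕ → C(K, ℝ), ∀ x, Tendsto (fun n => t n (ι x)) atTop (𝓝 (h x)) := by
  have hsum : Summable fun m : ℕ => 2 * (1 / 2 : ℝ) ^ m := summable_geometric_two.mul_left 2
  let clamp : ℕ → ℝ → ℝ := fun m r => max (-(2 * (1 / 2) ^ m)) (min (2 * (1 / 2) ^ m) r)
  have hclamp : ∀ m r, ‖clamp m r‖ ≤ 2 * (1 / 2) ^ m := fun m r => by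
    have : (0 : ℝ) ≤ 2 * (1 / 2) ^ m := by positivity
    exact abs_le.2 ⟨le_max_left _ _, max_le (by linarith) (min_le_left _ _)⟩
  have hclamp_eq : ∀ m r, |r| ≤ 2 * (1 / 2) ^ m → clamp m r = r := fun m r hr => by
    rw [abs_le] at hr
    simp only [clamp]
    rw [min_eq_right hr.2, max_eq_right hr.1]
  refine ⟨fun n => ⟨fun y => s 0 n y + ∑' m, clamp m (s (m + 1) n y - s m n y), ?_⟩, fun x => ?_⟩
  · exact (s 0 n).continuous.add
      (continuous_tsum (fun m => by fun_prop) hsum fun m y => hclamp _ _)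
  · have hterm : ∀ m, Tendsto (fun n => clamp m (s (m + 1) n (ι x) - s m n (ι x))) atTop
        (𝓝 (φ (m + 1) x - φ m x)) := fun m => by
      refine tendsto_const_nhds.congr' ?_
      filter_upwards [hs m x, hs (m + 1) x] with n h1 h2
      rw [h1, h2, hclamp_eq]
      have h3 := abs_le.1 (hφ m x)
      have h4 := abs_le.1 (hφ (m + 1) x)
      have h5 : (0 : ℝ) < (1 / 2) ^ m := by positivity
      rw [pow_succ] at h4
      exact abs_le.2 ⟨by linarith [h3.2, h4.1], by linarith [h3.1, h4.2]⟩
    have hlim := tendsto_tsum_of_dominated_convergence hsum hterm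
      (Eventually.of_forall fun n m => hclamp _ _)
    have hφlim : Tendsto (fun m => φ m x) atTop (𝓝 (h x)) := by
      rw [tendsto_iff_dist_tendsto_zero]
      exact squeeze_zero (fun _ => dist_nonneg) (fun m => hφ m x)
        (tendsto_pow_atTop_nhds_zero_of_lt_one (by norm_num) (by norm_num))
    have htel : ∑' m, (φ (m + 1) x - φ m x) = h x - φ 0 x := by
      have hS : Summable fun m => φ (m + 1) x - φ m x :=
        Summable.of_norm_bounded hsum fun m =>
          le_of_tendsto (hterm m).norm (Eventually.of_forall fun n => hclamp _ _)
      refine tendsto_nhds_unique hS.hasSum.tendsto_sum_nat ?_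
      simp_rw [Finset.sum_range_sub (fun m => φ m x)]
      exact hφlim.sub_const _
    rw [htel] at hlim
    have h0 : Tendsto (fun n => s 0 n (ι x)) atTop (𝓝 (φ 0 x)) :=
      tendsto_const_nhds.congr' ((hs 0 x).mono fun n hn => hn.symm)
    simpa using h0.add hlim

/-- If preimages of bounded open intervals under `h` are traces along `ι` of Fσ-sets of a
metrizable space `K`, then `h` is a pointwise limit of continuous functions on `K`. -/
theorem exists_continuousMap_tendsto_of_preimage_Ioo {X K : Type*} [TopologicalSpace K]
    [MetrizableSpace K] (ι : X → K) {h : X → ℝ}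
    (hh : ∀ a b : ℝ, ∃ C : ℕ → Set K, (∀ n, IsClosed (C n)) ∧ h ⁻¹' Ioo a b = ⋃ n, ι ⁻¹' C n) :
    ∃ t : ℕ → C(K, ℝ), ∀ x, Tendsto (fun n => t n (ι x)) atTop (𝓝 (h x)) := by
  choose C hC hCh using hh
  obtain ⟨e, he⟩ := exists_surjective_nat (ℚ × ℕ)
  have key : ∀ m : ℕ, ∃ (φ : X → ℝ) (s : ℕ → C(K, ℝ)),
      (∀ x, |φ x - h x| ≤ (1 / 2) ^ m) ∧ ∀ x, ∀ᶠ n in atTop, s n (ι x) = φ x := fun m => by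
    have hpos : (0 : ℝ) < (1 / 2) ^ m := by positivity
    obtain ⟨s, hs⟩ := exists_continuousMap_eventually_eq_of_closed_cover
      (E := fun k => C ((e k).1 - (1 / 2) ^ m) ((e k).1 + (1 / 2) ^ m) (e k).2)
      (fun k => hC _ _ _) (fun k => (e k).1)
    have hcover : ∀ x, ι x ∈ ⋃ k, C ((e k).1 - (1 / 2) ^ m) ((e k).1 + (1 / 2) ^ m) (e k).2 := by
      intro x
      obtain ⟨q, hq1, hq2⟩ := exists_rat_btwn
        (show h x - (1 / 2) ^ m < h x + (1 / 2) ^ m by linarith)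
      have hx : x ∈ h ⁻¹' Ioo ((q : ℝ) - (1 / 2) ^ m) (q + (1 / 2) ^ m) :=
        ⟨by linarith, by linarith⟩
      rw [hCh] at hx
      obtain ⟨n, hn⟩ := mem_iUnion.1 hx
      obtain ⟨k, hk⟩ := he (q, n)
      exact mem_iUnion.2 ⟨k, by rw [hk]; exact hn⟩
    choose k hk1 hk2 using fun x => hs (ι x) (hcover x)
    refine ⟨fun x => (e (k x)).1, s, fun x => ?_, hk2⟩
    have hx : x ∈ h ⁻¹' Ioo (((e (k x)).1 : ℝ) - (1 / 2) ^ m) ((e (k x)).1 + (1 / 2) ^ m) := by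
      rw [hCh]
      exact mem_iUnion.2 ⟨_, hk1 x⟩
    exact abs_le.2 ⟨by linarith [hx.2], by linarith [hx.1]⟩
  choose φ s hφ hs using key
  exact exists_continuousMap_tendsto_of_geometric ι hφ hs

/-- Preimages of open intervals under Baire class one functions are Zσ-sets. -/
theorem isZSigmaSet_preimage_Ioo {X : Type u} [TopologicalSpace X] {h : X → ℝ} (hh : h ∈ B1 X)
    (a b : ℝ) : IsZSigmaSet (h ⁻¹' Ioo a b) := by
  obtain ⟨g, hg, hlim⟩ := hh
  obtain ⟨e, he⟩ := exists_surjective_nat (ℕ × ℚ × ℚ)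
  let D : ℕ × ℚ × ℚ → Set (ℕ → ℝ) := fun p =>
    if a < p.2.1 ∧ (p.2.2 : ℝ) < b then ⋂ n ≥ p.1, {v | v n ∈ Icc (p.2.1 : ℝ) p.2.2} else ∅
  have hD : ∀ p, IsClosed (D p) := fun p => by
    simp only [D]
    split_ifs
    · exact isClosed_biInter fun n _ => isClosed_Icc.preimage (continuous_apply n)
    · exact isClosed_empty
  refine ⟨fun k => (fun x n => g n x) ⁻¹' D (e k),
    fun k => IsZeroSet.preimage (hD _) (continuous_pi hg), ?_⟩
  ext x
  simp only [mem_preimage, mem_iUnion]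
  constructor
  · rintro ⟨hax, hxb⟩
    obtain ⟨p, hap, hpx⟩ := exists_rat_btwn hax
    obtain ⟨q, hxq, hqb⟩ := exists_rat_btwn hxb
    obtain ⟨N, hN⟩ := eventually_atTop.1 ((hlim x).eventually (Icc_mem_nhds hpx hxq))
    obtain ⟨k, hk⟩ := he (N, p, q)
    refine ⟨k, ?_⟩
    simp only [hk, D, hap, hqb, and_self, if_true, mem_iInter]
    exact hN
  · rintro ⟨k, hk⟩
    simp only [D] at hk
    split_ifs at hk with hab
    · simp only [mem_iInter] at hk
      have := isClosed_Icc.mem_of_tendsto (hlim x) (eventually_atTop.2 ⟨_, hk⟩)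
      exact ⟨hab.1.trans_le this.1, this.2.trans_lt hab.2⟩
    · exact hk.elim

/-- A pointwise limit of continuous functions on a compact space is a pointwise limit of members
of any given dense sequence. -/
theorem exists_tendsto_of_denseRange {X K I : Type*} [TopologicalSpace K] [CompactSpace K]
    {ι : X → K} {d : I → C(K, ℝ)} (hd : DenseRange d) {h : X → ℝ} {t : ℕ → C(K, ℝ)}
    (ht : ∀ x, Tendsto (fun n => t n (ι x)) atTop (𝓝 (h x))) :
    ∃ i : ℕ → I, ∀ x, Tendsto (fun n => d (i n) (ι x)) atTop (𝓝 (h x)) := by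
  choose i hi using fun n : ℕ => hd.exists_dist_lt (t n) (Nat.one_div_pos_of_nat (n := n))
  refine ⟨i, fun x => (ht x).congr_dist (squeeze_zero (fun _ => dist_nonneg) (fun n => ?_)
    (tendsto_one_div_add_atTop_nhds_zero_nat (𝕜 := ℝ)))⟩
  exact (ContinuousMap.dist_apply_le_dist _).trans (hi n).le

/-- If a Tychonoff space `X` has property `U`, then there is a countable set `S` of
continuous functions on `X` with `[S]_seq = B₁(X)`. -/
theorem stmt3 (X : Type u) [TopologicalSpace X] [T2Space X] [CompletelyRegularSpace X]
    (h : PropertyU X) :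
    ∃ S : Set (X → ℝ), S.Countable ∧ (∀ f ∈ S, Continuous f) ∧
      ∀ f ∈ B1 X, ∃ g : ℕ → X → ℝ, (∀ n, g n ∈ S) ∧ PointwiseLimit g f := by
  obtain ⟨Y, _, _, _, f, hf, hbij, hD⟩ := h
  let := metrizableSpaceMetric Y
  obtain ⟨F, hF⟩ := Metric.PiNatEmbed.exists_embedding_to_hilbert_cube (X := Y)
  let d := denseSeq C(ℕ → unitInterval, ℝ)
  refine ⟨range fun n => d n ∘ F ∘ f, countable_range _, ?_, fun h hh => ?_⟩
  · rintro _ ⟨n, rfl⟩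
    exact (d n).continuous.comp (hF.continuous.comp hf)
  · have htrace : ∀ D : Set X, IsZeroSet D → ∃ C : ℕ → Set (ℕ → unitInterval),
        (∀ n, IsClosed (C n)) ∧ D = ⋃ n, (F ∘ f) ⁻¹' C n := fun D hZ => by
      obtain ⟨A, hA, hDA⟩ := hD D hZ
      choose C hC hCA using fun n => hF.isInducing.isClosed_iff.1 (hA n)
      refine ⟨C, hC, ?_⟩
      simp_rw [preimage_comp, hCA, ← preimage_iUnion, ← hDA, hbij.injective.preimage_image]
    have hIoo : ∀ a b : ℝ, ∃ C : ℕ → Set (ℕ → unitInterval),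
        (∀ n, IsClosed (C n)) ∧ h ⁻¹' Ioo a b = ⋃ n, (F ∘ f) ⁻¹' C n := fun a b => by
      obtain ⟨Z, hZ, hZh⟩ := isZSigmaSet_preimage_Ioo hh a b
      choose C hC hCZ using fun n => htrace (Z n) (hZ n)
      refine ⟨fun k => C k.unpair.1 k.unpair.2, fun k => hC _ _, ?_⟩
      rw [hZh, iUnion_unpair fun i j => (F ∘ f) ⁻¹' C i j]
      exact iUnion_congr hCZ
    obtain ⟨t, ht⟩ := exists_continuousMap_tendsto_of_preimage_Ioo (F ∘ f) hIoo
    obtain ⟨i, hi⟩ := exists_tendsto_of_denseRange (denseRange_denseSeq _) ht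
    exact ⟨fun n => d (i n) ∘ F ∘ f, fun n => mem_range_self _, hi⟩
end

section
/- Let X be a Tychonoff space. If the space USC^f(X), endowed with the topology of pointwise convergence, is sequentially separable, then C_p(X), the set of continuous real-valued functions on X endowed with the topology of pointwise convergence, is sequentially separable. -/
open Filter Topology Set TopologicalSpace

universe u

/-- `max (u 0) (min (l 0) (max (u 1) (min (l 1) ⋯ y)))`, with `k` nested clamps. -/
def nestedClamp {α : Type*} [Lattice α] (u l : ℕ → α) : ℕ → α → α
  | 0, y => y
  | k + 1, y => nestedClamp u l k (u k ⊔ l k ⊓ y)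

theorem nestedClamp_apply {X : Type*} (u l : ℕ → X → ℝ) (k : ℕ) (y : X → ℝ) (x : X) :
    nestedClamp u l k y x = nestedClamp (fun m => u m x) (fun m => l m x) k (y x) := by
  induction k generalizing y with
  | zero => rfl
  | succ k ih => exact ih _

theorem nestedClamp_mem {α : Type*} [Lattice α] {T : Set α} (hT : IsSublattice T)
    {u l : ℕ → α} (hu : ∀ m, u m ∈ T) (hl : ∀ m, l m ∈ T) (k : ℕ) {y : α} (hy : y ∈ T) :
    nestedClamp u l k y ∈ T := by
  induction k generalizing y with
  | zero => exact hy
  | succ k ih => exact ih (hT.supClosed (hu k) (hT.infClosed (hl k) hy))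

theorem nestedClamp_mem_Icc {u l : ℕ → ℝ} {a b : ℝ} {k : ℕ} {y : ℝ} (hy : y ∈ Icc a b)
    (hu : ∀ m < k, u m ≤ b) (hl : ∀ m < k, a ≤ l m) : nestedClamp u l k y ∈ Icc a b := by
  induction k generalizing y with
  | zero => exact hy
  | succ k ih =>
    refine ih ⟨?_, ?_⟩ (fun m hm => hu m (by omega)) (fun m hm => hl m (by omega))
    · exact le_sup_of_le_right (le_inf (hl k (by omega)) hy.1)
    · exact sup_le (hu k (by omega)) (inf_le_of_right_le hy.2)

/-- The clamp of index `M` forces the value into `[a, b]`, and the outer clamps keep it there. -/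
theorem nestedClamp_mem_Icc_of_lt {u l : ℕ → ℝ} {a b : ℝ} {M n : ℕ} (hMn : M < n) (y : ℝ)
    (hu : ∀ m ≤ M, u m ≤ b) (hl : ∀ m ≤ M, a ≤ l m) (huM : a ≤ u M) (hlM : l M ≤ b) :
    nestedClamp u l n y ∈ Icc a b := by
  induction n, hMn using Nat.le_induction generalizing y with
  | base =>
    change nestedClamp u l M (u M ⊔ l M ⊓ y) ∈ Icc a b
    exact nestedClamp_mem_Icc ⟨le_sup_of_le_left huM, sup_le (hu M le_rfl) (inf_le_of_left_le hlM)⟩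
      (fun m hm => hu m hm.le) (fun m hm => hl m hm.le)
  | succ n _ ih => exact ih _

theorem tendsto_nestedClamp {u l : ℕ → ℕ → ℝ} {c : ℝ}
    (hu : ∀ ε > 0, ∀ m, ∀ᶠ n in atTop, u m n ≤ c + ε)
    (hu' : ∀ ε > 0, ∀ᶠ m in atTop, ∀ᶠ n in atTop, c - ε ≤ u m n)
    (hl : ∀ ε > 0, ∀ m, ∀ᶠ n in atTop, c - ε ≤ l m n)
    (hl' : ∀ ε > 0, ∀ᶠ m in atTop, ∀ᶠ n in atTop, l m n ≤ c + ε) (y : ℝ) :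
    Tendsto (fun n => nestedClamp (fun m => u m n) (fun m => l m n) n y) atTop (𝓝 c) := by
  rw [(nhds_basis_Icc_pos c).tendsto_right_iff]
  intro ε hε
  obtain ⟨M, huM, hlM⟩ := ((hu' ε hε).and (hl' ε hε)).exists
  have hu_all : ∀ᶠ n in atTop, ∀ m ∈ Iic M, u m n ≤ c + ε :=
    (eventually_all_finite (finite_Iic M)).2 fun m _ => hu ε hε m
  have hl_all : ∀ᶠ n in atTop, ∀ m ∈ Iic M, c - ε ≤ l m n :=
    (eventually_all_finite (finite_Iic M)).2 fun m _ => hl ε hε m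
  filter_upwards [huM, hlM, hu_all, hl_all, eventually_gt_atTop M] with n h₁ h₂ h₃ h₄ h₅
  exact nestedClamp_mem_Icc_of_lt h₅ y h₃ h₄ h₁ h₂

theorem Set.Countable.supClosure {α : Type*} [SemilatticeSup α] {s : Set α} (hs : s.Countable) :
    (supClosure s).Countable := by
  have hfin : {t : Set α | t.Finite ∧ t ⊆ s}.Countable := countable_ofPred_finite_subset hs
  have hfin' : {t : Finset α | (t : Set α) ⊆ s}.Countable := by
    refine (hfin.preimage_of_injOn (Finset.coe_injective (α := α)).injOn).mono ?_
    exact fun t ht => ⟨t.finite_toSet, ht⟩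
  have : Countable {t : Finset α | (t : Set α) ⊆ s} := hfin'.to_subtype
  refine (countable_range fun t : {t : {t : Finset α | (t : Set α) ⊆ s} // t.1.Nonempty} =>
    t.1.1.sup' t.2 id).mono ?_
  rintro _ ⟨t, ht, hts, rfl⟩
  exact ⟨⟨⟨t, hts⟩, ht⟩, rfl⟩

theorem Set.Countable.infClosure {α : Type*} [SemilatticeInf α] {s : Set α} (hs : s.Countable) :
    (infClosure s).Countable :=
  Set.Countable.supClosure (α := αᵒᵈ) hs

theorem Set.Countable.latticeClosure {α : Type*} [DistribLattice α] {s : Set α}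
    (hs : s.Countable) : (latticeClosure s).Countable := by
  rw [← supClosure_infClosure]
  exact hs.infClosure.supClosure

theorem exists_continuous_eq_zero_iff_of_mem_USCf {X : Type u} [TopologicalSpace X] {s : X → ℝ}
    (hs : s ∈ USCf X) (r : ℝ) :
    ∃ e : X → ℝ, Continuous e ∧ (∀ x, 0 ≤ e x) ∧ ∀ x, e x = 0 ↔ r ≤ s x := by
  obtain ⟨g, hg, h⟩ := hs r
  refine ⟨fun x => |g x|, hg.abs, fun x => abs_nonneg _, fun x => ?_⟩
  simpa using (Set.ext_iff.1 h x).symm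

/-- Pointwise limits from a countable family of functions in `USC^f(X)` are approximated by
finite minima of functions from one countable family of continuous functions: `u m n` tends,
as `n → ∞`, to the infimum of the tail from `m` of the given sequence. -/
theorem exists_countable_continuous_of_subset_USCf {X : Type u} [TopologicalSpace X]
    {S : Set (X → ℝ)} (hS : S ⊆ USCf X) (hSc : S.Countable) :
    ∃ A : Set (X → ℝ), A.Countable ∧ (∀ a ∈ A, Continuous a) ∧
      ∀ (f : X → ℝ) (g : ℕ → X → ℝ), (∀ n, g n ∈ S) → PointwiseLimit g f →
        ∃ u : ℕ → ℕ → X → ℝ, (∀ m n, u m n ∈ infClosure A) ∧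
          (∀ x, ∀ ε > 0, ∀ m, ∀ᶠ n in atTop, u m n x ≤ f x + ε) ∧
          ∀ x, ∀ ε > 0, ∀ᶠ m in atTop, ∀ᶠ n in atTop, f x - ε ≤ u m n x := by
  have he : ∀ s ∈ S, ∀ r : ℝ, ∃ e : X → ℝ,
      Continuous e ∧ (∀ x, 0 ≤ e x) ∧ ∀ x, e x = 0 ↔ r ≤ s x :=
    fun s hs => exists_continuous_eq_zero_iff_of_mem_USCf (hS hs)
  choose! e he_cont he_nonneg he_zero using he
  obtain ⟨q, hq⟩ := exists_surjective_nat ℚ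
  let p : (X → ℝ) → ℕ → ℕ → X → ℝ := fun s i n x => max (q i : ℝ) (n * (1 - n * e s (q i) x))
  have : Countable S := hSc.to_subtype
  refine ⟨range fun z : S × ℕ × ℕ => p z.1 z.2.1 z.2.2, countable_range _, ?_, ?_⟩
  · rintro _ ⟨⟨s, i, n⟩, rfl⟩
    have := he_cont s s.2 (q i)
    simp only [p]
    fun_prop
  intro f g hg hlim
  have hne (n : ℕ) : (Finset.range (n + 1) ×ˢ Finset.range (n + 1)).Nonempty :=
    ⟨(0, 0), by simp⟩
  refine ⟨fun m n => (Finset.range (n + 1) ×ˢ Finset.range (n + 1)).inf' (hne n)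
    fun z => p (g (m + z.1)) z.2 n, fun m n => ?_, fun x ε hε m => ?_, fun x ε hε => ?_⟩
  · exact infClosed_infClosure.finsetInf'_mem (hne n) fun z _ =>
      subset_infClosure ⟨(⟨g (m + z.1), hg _⟩, z.2, n), rfl⟩
  · obtain ⟨k, hk, hkm⟩ :=
      (((hlim x).eventually_lt_const (by linarith : f x < f x + ε)).and
        (eventually_ge_atTop m)).exists
    obtain ⟨j, rfl⟩ := Nat.exists_eq_add_of_le hkm
    obtain ⟨r, hr, hr'⟩ := exists_rat_btwn hk
    obtain ⟨i, rfl⟩ := hq r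
    have hpos : 0 < e (g (m + j)) (q i) x := by
      refine (he_nonneg _ (hg _) _ x).lt_of_ne fun h => ?_
      exact hr.not_ge ((he_zero _ (hg _) _ x).1 h.symm)
    have hbot : Tendsto (fun n : ℕ => (n : ℝ) * (1 - n * e (g (m + j)) (q i) x)) atTop atBot :=
      tendsto_natCast_atTop_atTop.atTop_mul_atBot₀ <| tendsto_atBot_add_const_left _ (1 : ℝ) <|
        tendsto_neg_atTop_atBot.comp (tendsto_natCast_atTop_atTop.atTop_mul_const hpos)
    filter_upwards [hbot.eventually_le_atBot (q i : ℝ), eventually_ge_atTop i,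
      eventually_ge_atTop j] with n hn hi hj
    rw [Finset.inf'_apply]
    refine (Finset.inf'_le _ (b := (j, i)) (by simp; omega)).trans ?_
    exact (max_le le_rfl hn).trans hr'.le
  · have htail := (hlim x).eventually_const_le (by linarith : f x - ε < f x)
    obtain ⟨M, hM⟩ := eventually_atTop.1 htail
    filter_upwards [eventually_ge_atTop M] with m hm
    filter_upwards [tendsto_natCast_atTop_atTop.eventually_ge_atTop (f x)] with n hn
    rw [Finset.inf'_apply]
    refine Finset.le_inf' _ _ fun z _ => ?_
    rcases le_or_gt (q z.2 : ℝ) (g (m + z.1) x) with h | h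
    · refine le_max_of_le_right ?_
      rw [(he_zero _ (hg _) _ x).2 h]
      linarith
    · exact le_max_of_le_left ((hM _ (by omega)).trans h.le)

theorem Continuous.mem_USCf {X : Type u} [TopologicalSpace X] {f : X → ℝ} (hf : Continuous f) :
    f ∈ USCf X := by
  refine fun r => ⟨fun x => max (r - f x) 0, by fun_prop, ?_⟩
  ext x
  simp

/-- If `USC^f(X)` is sequentially separable for a Tychonoff space `X`, then so is `C_p(X)`. -/
theorem stmt4 (X : Type u) [TopologicalSpace X] [T2Space X] [CompletelyRegularSpace X]
    (h : SeqSeparable (USCf X)) :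
    SeqSeparable {f : X → ℝ | Continuous f} := by
  obtain ⟨S, hS, hSc, hlim⟩ := h
  obtain ⟨A, hA, hAcont, hAapprox⟩ := exists_countable_continuous_of_subset_USCf hS hSc
  let B : Set (X → ℝ) := A ∪ (fun a => -a) '' A
  have hB : latticeClosure B ⊆ {f : X → ℝ | Continuous f} := by
    refine latticeClosure_min (union_subset hAcont ?_)
      ⟨fun a ha b hb => ha.sup hb, fun a ha b hb => ha.inf hb⟩
    rintro _ ⟨a, ha, rfl⟩
    exact (hAcont a ha).neg
  have hT : IsSublattice (latticeClosure B) := isSublattice_latticeClosure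
  have hpos : infClosure A ⊆ latticeClosure B :=
    infClosure_min (subset_union_left.trans subset_latticeClosure) hT.infClosed
  have hneg : infClosure A ⊆ {a | -a ∈ latticeClosure B} := by
    refine infClosure_min
      (fun a ha => subset_latticeClosure (Or.inr ⟨a, ha, rfl⟩)) fun a ha b hb => ?_
    simpa only [mem_ofPred_eq, neg_inf] using hT.supClosed ha hb
  refine ⟨latticeClosure B, hB, (hA.union (hA.image _)).latticeClosure, fun f hf => ?_⟩
  obtain ⟨g, hg, hgf⟩ := hlim f (Continuous.mem_USCf hf)
  obtain ⟨k, hk, hkf⟩ := hlim (-f) (Continuous.mem_USCf (Continuous.neg hf))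
  obtain ⟨u, hu, hu₁, hu₂⟩ := hAapprox f g hg hgf
  obtain ⟨v, hv, hv₁, hv₂⟩ := hAapprox (-f) k hk hkf
  refine ⟨fun n => nestedClamp (fun m => u m n) (fun m => -v m n) n (u 0 0), fun n =>
    nestedClamp_mem hT (fun m => hpos (hu m n)) (fun m => hneg (hv m n)) n (hpos (hu 0 0)),
    fun x => ?_⟩
  simp only [nestedClamp_apply]
  refine tendsto_nestedClamp (u := fun m n => u m n x) (l := fun m n => -v m n x)
    (hu₁ x) (hu₂ x) (fun ε hε m => ?_) (fun ε hε => ?_) (u 0 0 x)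
  · filter_upwards [hv₁ x ε hε m] with n hn
    simp only [Pi.neg_apply] at hn
    linarith
  · filter_upwards [hv₂ x ε hε] with m hm
    filter_upwards [hm] with n hn
    simp only [Pi.neg_apply] at hn
    linarith
end

section
/- Let X be a separable metrizable space. Then the space USC(X) of all upper semicontinuous real-valued functions on X, endowed with the topology of pointwise convergence, is sequentially separable. -/
open Filter Topology Set TopologicalSpace

universe u

open scoped Classical in
/-- The minimum of the constant `N` and of those values `p.2`, for `p ∈ t`, for which `x ∈ p.1`. -/
noncomputable def minStep {X : Type u} (t : Finset (Set X × ℚ)) (N : ℕ) (x : X) : ℝ :=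
  t.fold min (N : ℝ) fun p => if x ∈ p.1 then (p.2 : ℝ) else N

theorem minStep_lt_iff {X : Type u} {t : Finset (Set X × ℚ)} {N : ℕ} {x : X} {r : ℝ} :
    minStep t N x < r ↔ (N : ℝ) < r ∨ ∃ p ∈ t, x ∈ p.1 ∧ (p.2 : ℝ) < r := by
  rw [minStep, Finset.fold_min_lt]
  grind

theorem lt_minStep {X : Type u} {t : Finset (Set X × ℚ)} {N : ℕ} {x : X} {r : ℝ}
    (hN : r < N) (ht : ∀ p ∈ t, x ∈ p.1 → r < (p.2 : ℝ)) : r < minStep t N x := by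
  rw [minStep, Finset.lt_fold_min]
  grind

theorem minStep_mem_USC {X : Type u} [TopologicalSpace X] {t : Finset (Set X × ℚ)}
    (ht : ∀ p ∈ t, IsOpen p.1) (N : ℕ) : minStep t N ∈ USC X := by
  intro r
  have h : {x | minStep t N x < r} =
      {_x : X | (N : ℝ) < r} ∪ ⋃ p ∈ t, {x | x ∈ p.1 ∧ (p.2 : ℝ) < r} := by
    ext x
    simp only [mem_ofPred_eq, minStep_lt_iff, mem_union, mem_iUnion, exists_prop]
  rw [h]
  exact isOpen_const.union (isOpen_biUnion fun p hp => (ht p hp).inter isOpen_const)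

theorem seqSeparable_USC (X : Type u) [TopologicalSpace X] [SecondCountableTopology X] :
    SeqSeparable (USC X) := by
  classical
  let φ : countableBasis X × ℚ ↪ Set X × ℚ :=
    ⟨Prod.map Subtype.val id, Subtype.val_injective.prodMap Function.injective_id⟩
  have : Countable (countableBasis X) := (countable_countableBasis X).to_subtype
  refine ⟨range fun p : Finset (countableBasis X × ℚ) × ℕ => minStep (p.1.map φ) p.2, ?_,
    countable_range _, fun f hf => ?_⟩
  · rintro _ ⟨⟨t, N⟩, rfl⟩
    refine minStep_mem_USC (fun p hp => ?_) N
    obtain ⟨q, -, rfl⟩ := Finset.mem_map.1 hp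
    exact isOpen_of_mem_countableBasis q.1.2
  obtain ⟨s, hs⟩ := exists_seq_tendsto (atTop : Filter (Finset (countableBasis X × ℚ)))
  let valid (p : countableBasis X × ℚ) : Prop := ∀ x ∈ p.1.1, f x < (p.2 : ℝ)
  refine ⟨fun n => minStep (((s n).filter valid).map φ) n,
    fun n => ⟨((s n).filter valid, n), rfl⟩, fun x => tendsto_order.2 ⟨fun a ha => ?_, fun a ha => ?_⟩⟩
  · filter_upwards [tendsto_natCast_atTop_atTop.eventually_gt_atTop a] with n hn
    refine lt_minStep hn fun p hp hx => ?_
    obtain ⟨q, hq, rfl⟩ := Finset.mem_map.1 hp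
    exact ha.trans ((Finset.mem_filter.1 hq).2 x hx)
  · obtain ⟨q, hfq, hqa⟩ := exists_rat_btwn ha
    obtain ⟨B, hB, hxB, hBf⟩ :=
      (isBasis_countableBasis X).exists_subset_of_mem_open (show x ∈ {y | f y < q} from hfq) (hf q)
    filter_upwards [hs.eventually_ge_atTop {(⟨B, hB⟩, q)}] with n hn
    refine minStep_lt_iff.2 (.inr ⟨(B, q), Finset.mem_map.2 ⟨(⟨B, hB⟩, q), ?_, rfl⟩, hxB, hqa⟩)
    exact Finset.mem_filter.2 ⟨Finset.singleton_subset_iff.1 hn, fun y hy => hBf hy⟩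

/-- For a separable metrizable space `X`, the space `USC_p(X)` is sequentially separable. -/
theorem stmt7 (X : Type u) [TopologicalSpace X] [MetrizableSpace X] [SeparableSpace X] :
    SeqSeparable (USC X) := by
  let := metrizableSpaceMetric X
  have := UniformSpace.secondCountable_of_separable X
  exact seqSeparable_USC X
end

section
/- Let X be a separable metrizable space. Then B₁(X), endowed with the topology of pointwise convergence, is sequentially separable. -/
open Filter Topology Set TopologicalSpace

universe u

/-- Closed sets of a perfectly normal space have indicators that are pointwise limits of
continuous functions equal to `1` on the set. -/
lemma exists_continuous_tendsto_indicator_of_isClosed {Q : Type*} [TopologicalSpace Q]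
    [PerfectlyNormalSpace Q] {C : Set Q} (hC : IsClosed C) :
    ∃ u : ℕ → Q → ℝ, (∀ n, Continuous (u n)) ∧ (∀ n, ∀ y ∈ C, u n y = 1) ∧
      ∀ y ∉ C, Tendsto (fun n => u n y) atTop (𝓝 0) := by
  obtain ⟨f, rfl, hf⟩ :=
    perfectlyNormalSpace_iff_forall_isClosed_preimage_zero.1 inferInstance C hC
  refine ⟨fun n y => (1 - f y) ^ n, fun n => by fun_prop, fun n y hy => ?_, fun y hy => ?_⟩
  · have : f y = 0 := hy
    simp [this]
  · have h0 : f y ≠ 0 := hy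
    have h1 := hf y
    have h2 : 0 < f y := lt_of_le_of_ne h1.1 h0.symm
    exact tendsto_pow_atTop_nhds_zero_of_lt_one (by linarith [h1.2]) (by linarith)

/-- Given a sequence of closed sets `C k` and reals `q k`, some sequence of continuous functions
converges, at each point of `⋃ k, C k`, to `q k` for the first `k` such that `C k` contains it. -/
lemma exists_continuous_tendsto_of_first_mem {Q : Type*} [TopologicalSpace Q]
    [PerfectlyNormalSpace Q] {C : ℕ → Set Q} (hC : ∀ k, IsClosed (C k)) (q : ℕ → ℝ) :
    ∃ G : ℕ → Q → ℝ, (∀ n, Continuous (G n)) ∧ ∀ y k, y ∈ C k → (∀ j < k, y ∉ C j) →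
      Tendsto (fun n => G n y) atTop (𝓝 (q k)) := by
  choose u hu hu1 hu0 using fun k => exists_continuous_tendsto_indicator_of_isClosed (hC k)
  refine ⟨fun n y => ∑ k ∈ Finset.range n, q k * (u k n y * ∏ j ∈ Finset.range k, (1 - u j n y)),
    fun n => ?_, fun y k hk hj => ?_⟩
  · fun_prop
  have hprod : Tendsto (fun n => ∏ j ∈ Finset.range k, (1 - u j n y)) atTop (𝓝 1) := by
    have := tendsto_finsetProd (Finset.range k) (f := fun j n => 1 - u j n y) (x := atTop)
      (a := fun _ => 1) fun j hjk => by
        simpa using (hu0 j y (hj j (Finset.mem_range.1 hjk))).const_sub 1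
    simpa using this
  have hlow : Tendsto (fun n => ∑ i ∈ Finset.range k,
      q i * (u i n y * ∏ j ∈ Finset.range i, (1 - u j n y))) atTop (𝓝 0) := by
    have := tendsto_finsetSum (Finset.range k)
      (f := fun i n => q i * (u i n y * ∏ j ∈ Finset.range i, (1 - u j n y))) (x := atTop)
      (a := fun _ => 0) fun i hik => by
        have hik := Finset.mem_range.1 hik
        have hp := tendsto_finsetProd (Finset.range i) (f := fun j n => 1 - u j n y) (x := atTop)
          (a := fun _ => 1) fun j hji => by
            simpa using (hu0 j y (hj j ((Finset.mem_range.1 hji).trans hik))).const_sub 1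
        simpa using ((hu0 i y (hj i hik)).mul hp).const_mul (q i)
    simpa using this
  have hsum : Tendsto (fun n => ∑ i ∈ Finset.range (k + 1),
      q i * (u i n y * ∏ j ∈ Finset.range i, (1 - u j n y))) atTop (𝓝 (q k)) := by
    simp only [Finset.sum_range_succ, hu1 k _ y hk]
    simpa using hlow.add ((hprod.const_mul 1).const_mul (q k))
  refine hsum.congr' ?_
  filter_upwards [eventually_ge_atTop (k + 1)] with n hn
  refine Finset.sum_subset (Finset.range_mono hn) fun i _ hi => ?_
  have hki : k < i := by simpa using hi
  rw [Finset.prod_eq_zero (Finset.mem_range.2 hki) (by simp [hu1 k n y hk])]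
  simp

/-- Uniform limits of pointwise limits of continuous functions restricted along `H` are again
such pointwise limits. -/
lemma exists_continuous_tendsto_of_geometric_approx {X Q : Type*} [TopologicalSpace Q] (H : X → Q)
    {f : X → ℝ} {g : ℕ → X → ℝ} (hg : ∀ m x, |g m x - f x| ≤ (1 / 2) ^ m)
    (h : ∀ m, ∃ F : ℕ → Q → ℝ, (∀ n, Continuous (F n)) ∧
      ∀ x, Tendsto (fun n => F n (H x)) atTop (𝓝 (g m x))) :
    ∃ F : ℕ → Q → ℝ, (∀ n, Continuous (F n)) ∧
      ∀ x, Tendsto (fun n => F n (H x)) atTop (𝓝 (f x)) := by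
  choose F hFc hF using h
  let G : ℕ → ℕ → Q → ℝ := fun m => Nat.rec (F 0)
    (fun m G n y => max (G n y - 2 * (1 / 2) ^ m) (min (F (m + 1) n y) (G n y + 2 * (1 / 2) ^ m))) m
  have hGs : ∀ m n y, G (m + 1) n y =
      max (G m n y - 2 * (1 / 2) ^ m) (min (F (m + 1) n y) (G m n y + 2 * (1 / 2) ^ m)) :=
    fun _ _ _ => rfl
  have hGc : ∀ m n, Continuous (G m n) := by
    intro m
    induction m with
    | zero => exact hFc 0
    | succ m ih =>
      intro n
      have := ih n
      have := hFc (m + 1) n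
      change Continuous fun y => G (m + 1) n y
      simp only [hGs]
      fun_prop
  have hGlim : ∀ m x, Tendsto (fun n => G m n (H x)) atTop (𝓝 (g m x)) := by
    intro m x
    induction m with
    | zero => exact hF 0 x
    | succ m ih =>
      simp only [hGs]
      convert (ih.sub_const (2 * (1 / 2) ^ m)).max
        ((hF (m + 1) x).min (ih.add_const (2 * (1 / 2) ^ m))) using 2
      have h1 := abs_le.1 (hg m x)
      have h2 := abs_le.1 (hg (m + 1) x)
      have h3 : (0 : ℝ) < (1 / 2) ^ m := by positivity
      rw [pow_succ] at h2
      rw [min_eq_left (by linarith), max_eq_right (by linarith)]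
  have hGdist : ∀ m k n y, |G (m + k) n y - G m n y| ≤ 4 * (1 / 2) ^ m - 4 * (1 / 2) ^ (m + k) := by
    intro m k n y
    induction k with
    | zero => simp
    | succ k ih =>
      have h3 : (0 : ℝ) < (1 / 2) ^ (m + k) := by positivity
      have h1 : |G (m + k + 1) n y - G (m + k) n y| ≤ 2 * (1 / 2) ^ (m + k) := by
        rw [hGs, abs_le]
        constructor
        · linarith [le_max_left (G (m + k) n y - 2 * (1 / 2) ^ (m + k))
            (min (F (m + k + 1) n y) (G (m + k) n y + 2 * (1 / 2) ^ (m + k)))]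
        · rw [sub_le_iff_le_add]
          exact max_le (by linarith) ((min_le_right _ _).trans (by linarith))
      have h2 := abs_sub_le (G (m + k + 1) n y) (G (m + k) n y) (G m n y)
      rw [← add_assoc, pow_succ]
      linarith
  refine ⟨fun n => G n n, fun n => hGc n n, fun x => ?_⟩
  rw [Metric.tendsto_atTop]
  intro ε hε
  obtain ⟨m, hm⟩ := exists_pow_lt_of_lt_one (show 0 < ε / 6 by linarith)
    (show (1 / 2 : ℝ) < 1 by norm_num)
  obtain ⟨N, hN⟩ := Metric.tendsto_atTop.1 (hGlim m x) (ε / 6) (by linarith)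
  refine ⟨max m N, fun n hn => ?_⟩
  have h1 := hN n (le_of_max_le_right hn)
  obtain ⟨k, rfl⟩ := Nat.exists_eq_add_of_le (le_of_max_le_left hn)
  have h2 := hGdist m k (m + k) (H x)
  have h3 := hg m x
  have h4 : (0 : ℝ) < (1 / 2) ^ (m + k) := by positivity
  rw [Real.dist_eq] at h1 ⊢
  have h5 := abs_sub_le (G (m + k) (m + k) (H x)) (G m (m + k) (H x)) (f x)
  have h6 := abs_sub_le (G m (m + k) (H x)) (g m x) (f x)
  linarith

/-- A Baire class one function is covered by countably many closed sets on each of which it is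
within `ε` of a constant. -/
lemma exists_isClosed_cover_of_mem_B1 {X : Type u} [TopologicalSpace X] {f : X → ℝ}
    (hf : f ∈ B1 X) {ε : ℝ} (hε : 0 < ε) :
    ∃ (C : ℕ → Set X) (q : ℕ → ℝ), (∀ k, IsClosed (C k)) ∧ (∀ x, ∃ k, x ∈ C k) ∧
      ∀ k, ∀ x ∈ C k, |q k - f x| ≤ ε := by
  obtain ⟨g, hgc, hg⟩ := hf
  obtain ⟨e, he⟩ := exists_surjective_nat (ℚ × ℕ)
  refine ⟨fun k => {x | ∀ i ≥ (e k).2, |((e k).1 : ℝ) - g i x| ≤ ε}, fun k => (e k).1,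
    fun k => ?_, fun x => ?_, fun k x hx => ?_⟩
  · simp only [ofPred_forall]
    refine isClosed_iInter fun i => isClosed_iInter fun _ => ?_
    have := hgc i
    exact isClosed_le (by fun_prop) continuous_const
  · obtain ⟨r, hr1, hr2⟩ := exists_rat_btwn (show f x < f x + ε / 2 by linarith)
    obtain ⟨N, hN⟩ := Metric.tendsto_atTop.1 (hg x) (ε / 2) (by linarith)
    obtain ⟨k, hk⟩ := he (r, N)
    refine ⟨k, fun i hi => ?_⟩
    rw [hk] at hi ⊢
    have h1 := hN i hi
    rw [Real.dist_eq, abs_lt] at h1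
    rw [abs_le]
    constructor <;> dsimp only <;> linarith
  · refine le_of_tendsto ((hg x).const_sub ((e k).1 : ℝ)).abs ?_
    filter_upwards [eventually_ge_atTop (e k).2] with i hi using hx i hi

/-- A Baire class one function on a subspace of a perfectly normal space is a pointwise limit of
restrictions of continuous functions on the whole space. -/
lemma exists_continuous_tendsto_of_mem_B1 {X : Type u} {Q : Type*} [TopologicalSpace X]
    [TopologicalSpace Q] [PerfectlyNormalSpace Q] {H : X → Q} (hH : IsInducing H)
    {f : X → ℝ} (hf : f ∈ B1 X) :
    ∃ F : ℕ → Q → ℝ, (∀ n, Continuous (F n)) ∧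
      ∀ x, Tendsto (fun n => F n (H x)) atTop (𝓝 (f x)) := by
  classical
  choose C q hC hcov hq using fun m : ℕ =>
    exists_isClosed_cover_of_mem_B1 hf (show (0 : ℝ) < (1 / 2) ^ m by positivity)
  refine exists_continuous_tendsto_of_geometric_approx H
    (g := fun m x => q m (Nat.find (hcov m x)))
    (fun m x => hq m _ x (Nat.find_spec (hcov m x))) fun m => ?_
  choose K hK hKC using fun k => hH.isClosed_iff.1 (hC m k)
  obtain ⟨G, hGc, hG⟩ := exists_continuous_tendsto_of_first_mem hK (q m)
  have hmem : ∀ x k, H x ∈ K k ↔ x ∈ C m k := fun x k => by rw [← hKC k, mem_preimage]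
  refine ⟨G, hGc, fun x => hG _ _ ((hmem _ _).2 (Nat.find_spec (hcov m x))) fun j hj => ?_⟩
  rw [hmem]
  exact Nat.find_min (hcov m x) hj

/-- For a separable metrizable space `X`, the space `B₁(X)` is sequentially separable. -/
theorem stmt8 (X : Type u) [TopologicalSpace X] [MetrizableSpace X] [SeparableSpace X] :
    SeqSeparable (B1 X) := by
  let := metrizableSpaceMetric X
  obtain ⟨H, hH⟩ := Metric.PiNatEmbed.exists_embedding_to_hilbert_cube (X := X)
  refine ⟨range fun n => denseSeq C(ℕ → unitInterval, ℝ) n ∘ H, ?_, countable_range _,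
    fun f hf => ?_⟩
  · rintro _ ⟨n, rfl⟩
    exact ⟨fun _ => denseSeq C(ℕ → unitInterval, ℝ) n ∘ H,
      fun _ => (map_continuous _).comp hH.continuous, fun _ => tendsto_const_nhds⟩
  · obtain ⟨F, hFc, hF⟩ := exists_continuous_tendsto_of_mem_B1 hH.isInducing hf
    choose k hk using fun n : ℕ => (denseRange_denseSeq C(ℕ → unitInterval, ℝ)).exists_dist_lt
      ⟨F n, hFc n⟩ (Nat.one_div_pos_of_nat (α := ℝ) (n := n))
    refine ⟨fun n => denseSeq C(ℕ → unitInterval, ℝ) (k n) ∘ H, fun n => ⟨k n, rfl⟩, fun x => ?_⟩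
    refine (hF x).congr_dist (squeeze_zero (fun _ => dist_nonneg) (fun n => ?_)
      tendsto_one_div_add_atTop_nhds_zero_nat)
    exact (ContinuousMap.dist_apply_le_dist (f := ⟨F n, hFc n⟩) (H x)).trans (hk n).le
end

section
/- Let X be a separable metrizable space. Then there exists a countable set S of continuous real-valued functions on X such that every function in B₁(X) is the pointwise limit of a sequence of elements of S. -/
open Filter Topology Set TopologicalSpace

universe u

/-- Every countable set is contained in a countable set closed under countably many given binary
operations. -/
theorem Set.Countable.exists_superset_closed {α ι : Type*} [Countable ι] (op : ι → α → α → α)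
    {s : Set α} (hs : s.Countable) :
    ∃ t : Set α, t.Countable ∧ s ⊆ t ∧ ∀ i, ∀ a ∈ t, ∀ b ∈ t, op i a b ∈ t := by
  let T : ℕ → Set α := fun n => Nat.rec s (fun _ t => t ∪ ⋃ i, Set.image2 (op i) t t) n
  have hT : ∀ n, T (n + 1) = T n ∪ ⋃ i, Set.image2 (op i) (T n) (T n) := fun n => rfl
  have hmono : Monotone T := monotone_nat_of_le_succ fun n => by
    rw [hT]; exact subset_union_left
  refine ⟨⋃ n, T n, countable_iUnion fun n => ?_, subset_iUnion T 0, ?_⟩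
  · induction n with
    | zero => exact hs
    | succ n ih => exact ih.union (countable_iUnion fun i => ih.image2 ih (op i))
  · intro i a ha b hb
    obtain ⟨m, hm⟩ := mem_iUnion.1 ha
    obtain ⟨n, hn⟩ := mem_iUnion.1 hb
    refine mem_iUnion.2 ⟨max m n + 1, ?_⟩
    rw [hT]
    exact Or.inr (mem_iUnion.2 ⟨i, mem_image2_of_mem (hmono (le_max_left m n) hm)
      (hmono (le_max_right m n) hn)⟩)

/-- In a separable metrizable space, countably many continuous functions into `[0, 1]` separate
points from closed sets. -/
theorem exists_countable_separating_points_closed (X : Type*) [TopologicalSpace X]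
    [MetrizableSpace X] [SeparableSpace X] :
    ∃ C : Set C(X, ℝ), C.Countable ∧ (∀ c ∈ C, ∀ x, c x ∈ Icc (0 : ℝ) 1) ∧
      ∀ F : Set X, IsClosed F → ∀ x ∉ F, ∃ c ∈ C, (∀ y ∈ F, c y = 1) ∧ c x < 1 := by
  let := metrizableSpaceMetric X
  obtain ⟨t, htc, htd⟩ := exists_countable_dense X
  let c : X × ℕ → C(X, ℝ) := fun p =>
    ⟨fun y => min 1 ((p.2 + 1 : ℝ) * dist y p.1), by fun_prop⟩
  refine ⟨c '' (t ×ˢ univ), (htc.prod countable_univ).image _, ?_, ?_⟩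
  · rintro _ ⟨p, -, rfl⟩ x
    exact ⟨le_min zero_le_one (by positivity), min_le_left _ _⟩
  · intro F hF x hx
    obtain ⟨ε, hε, hball⟩ := Metric.isOpen_iff.1 hF.isOpen_compl x hx
    obtain ⟨n, hn⟩ := exists_nat_one_div_lt (half_pos hε)
    have hn0 : (0 : ℝ) < n + 1 := by positivity
    obtain ⟨z, hz, hxz⟩ := htd.exists_dist_lt x (one_div_pos.2 hn0)
    refine ⟨c (z, n), mem_image_of_mem _ ⟨hz, mem_univ _⟩, fun y hy => ?_, ?_⟩
    · refine min_eq_left ?_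
      by_contra! hlt
      have hyz : dist y z < 1 / (n + 1 : ℝ) := by
        rw [lt_div_iff₀ hn0]; linarith
      refine hball (Metric.mem_ball.2 ?_) hy
      have := dist_triangle_right y x z
      linarith
    · refine min_lt_of_right_lt ?_
      rw [lt_div_iff₀ hn0] at hxz
      change (n + 1 : ℝ) * dist x z < 1
      linarith

/-- The indicator of a closed set is a pointwise limit of functions in a multiplicatively closed
family separating points from closed sets. -/
theorem exists_seq_tendsto_indicator_of_isClosed {X : Type*} [TopologicalSpace X]
    {C : Set C(X, ℝ)} {S : Submonoid C(X, ℝ)} (hC : C.Countable) (hCS : C ⊆ S)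
    (hC01 : ∀ c ∈ C, ∀ x, c x ∈ Icc (0 : ℝ) 1)
    (hsep : ∀ F : Set X, IsClosed F → ∀ x ∉ F, ∃ c ∈ C, (∀ y ∈ F, c y = 1) ∧ c x < 1)
    {F : Set X} (hF : IsClosed F) :
    ∃ u : ℕ → C(X, ℝ), (∀ n, u n ∈ S) ∧ (∀ n, ∀ x ∈ F, u n x = 1) ∧
      ∀ x ∉ F, Tendsto (fun n => u n x) atTop (𝓝 0) := by
  let D : Set C(X, ℝ) := insert 1 {c ∈ C | ∀ y ∈ F, c y = 1}
  have hD : D.Countable := (hC.mono (sep_subset _ _)).insert 1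
  obtain ⟨c, hc⟩ := hD.exists_eq_range (insert_nonempty _ _)
  have hcD : ∀ i, c i ∈ D := fun i => hc ▸ mem_range_self i
  have hcS : ∀ i, c i ∈ S := fun i => by
    rcases hcD i with h | h
    · rw [h]; exact S.one_mem
    · exact hCS h.1
  have hcF : ∀ i, ∀ x ∈ F, c i x = 1 := fun i x hx => by
    rcases hcD i with h | h
    · rw [h]; rfl
    · exact h.2 x hx
  have hc01 : ∀ i x, c i x ∈ Icc (0 : ℝ) 1 := fun i x => by
    rcases hcD i with h | h
    · rw [h]; exact ⟨zero_le_one, le_rfl⟩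
    · exact hC01 _ h.1 x
  refine ⟨fun n => (∏ i ∈ Finset.range n, c i) ^ n,
    fun n => S.pow_mem (S.prod_mem fun i _ => hcS i) n, fun n x hx => ?_, fun x hx => ?_⟩
  · simp [ContinuousMap.prod_apply, Finset.prod_congr rfl fun i _ => hcF i x hx]
  · obtain ⟨d, hdC, hdF, hdx⟩ := hsep F hF x hx
    obtain ⟨l, rfl⟩ : d ∈ range c := hc ▸ Or.inr ⟨hdC, hdF⟩
    have h0 : ∀ n, 0 ≤ ∏ i ∈ Finset.range n, c i x :=
      fun n => Finset.prod_nonneg fun i _ => (hc01 i x).1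
    refine tendsto_of_tendsto_of_tendsto_of_le_of_le' tendsto_const_nhds
      (tendsto_pow_atTop_nhds_zero_of_lt_one (hc01 l x).1 hdx)
      (Eventually.of_forall fun n => ?_) ?_
    · simpa [ContinuousMap.prod_apply] using pow_nonneg (h0 n) n
    · filter_upwards [eventually_gt_atTop l] with n hn
      simp only [ContinuousMap.pow_apply, ContinuousMap.prod_apply]
      refine pow_le_pow_left₀ (h0 n) ?_ n
      rw [← Finset.mul_prod_erase _ _ (Finset.mem_range.2 hn)]
      exact mul_le_of_le_one_right (hc01 l x).1
        (Finset.prod_le_one (fun i _ => (hc01 i x).1) fun i _ => (hc01 i x).2)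

/-- A function taking the value `r i` on `F i \ ⋃ j < i, F j` is a pointwise limit of functions in
a ring containing the constants `r i`, provided the indicators of the `F i` are. -/
theorem exists_seq_tendsto_of_cover {X : Type*} [TopologicalSpace X] {S : Subring C(X, ℝ)}
    {F : ℕ → Set X} (hcover : ∀ x, ∃ i, x ∈ F i) {r : ℕ → ℝ}
    (hr : ∀ i, ContinuousMap.const X (r i) ∈ S)
    (hF : ∀ i, ∃ u : ℕ → C(X, ℝ), (∀ n, u n ∈ S) ∧ (∀ n, ∀ x ∈ F i, u n x = 1) ∧
      ∀ x ∉ F i, Tendsto (fun n => u n x) atTop (𝓝 0)) :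
    ∃ s : ℕ → C(X, ℝ), (∀ n, s n ∈ S) ∧
      ∀ x, ∃ i, x ∈ F i ∧ Tendsto (fun n => s n x) atTop (𝓝 (r i)) := by
  classical
  choose u huS hu1 hu0 using hF
  refine ⟨fun n => ∑ i ∈ Finset.range n,
      ContinuousMap.const X (r i) * (u i n * ∏ j ∈ Finset.range i, (1 - u j n)),
    fun n => S.sum_mem fun i _ => S.mul_mem (hr i) (S.mul_mem (huS i n)
      (S.prod_mem fun j _ => S.sub_mem S.one_mem (huS j n))), fun x => ?_⟩
  have hk := Nat.find_spec (hcover x)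
  have hlt : ∀ j, j < Nat.find (hcover x) → x ∉ F j := fun j hj => Nat.find_min (hcover x) hj
  set k := Nat.find (hcover x)
  refine ⟨k, hk, ?_⟩
  let v : ℕ → ℝ := fun j => if j = k then 1 else 0
  have hv : ∀ j ≤ k, Tendsto (fun n => u j n x) atTop (𝓝 (v j)) := fun j hj => by
    rcases hj.eq_or_lt with rfl | hj
    · simp [v, hu1 _ _ x hk]
    · simpa [v, hj.ne] using hu0 j x (hlt j hj)
  have hlim : Tendsto (fun n => ∑ i ∈ Finset.range (k + 1),
      r i * (u i n x * ∏ j ∈ Finset.range i, (1 - u j n x))) atTop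
      (𝓝 (∑ i ∈ Finset.range (k + 1), r i * (v i * ∏ j ∈ Finset.range i, (1 - v j)))) := by
    refine tendsto_finsetSum _ fun i hi => ?_
    have hik : i ≤ k := Nat.lt_succ_iff.1 (Finset.mem_range.1 hi)
    refine ((hv i hik).mul (tendsto_finsetProd _ fun j hj => ?_)).const_mul _
    exact (hv j ((Finset.mem_range.1 hj).le.trans hik)).const_sub 1
  have hsum : ∑ i ∈ Finset.range (k + 1), r i * (v i * ∏ j ∈ Finset.range i, (1 - v j)) = r k := by
    rw [Finset.sum_range_succ, Finset.sum_eq_zero, Finset.prod_eq_one]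
    · simp [v]
    · intro j hj
      simp [v, (Finset.mem_range.1 hj).ne]
    · intro i hi
      simp [v, (Finset.mem_range.1 hi).ne]
  rw [hsum] at hlim
  refine hlim.congr' ?_
  filter_upwards [eventually_gt_atTop k] with n hn
  simp only [ContinuousMap.sum_apply, ContinuousMap.mul_apply, ContinuousMap.const_apply,
    ContinuousMap.prod_apply, ContinuousMap.sub_apply, ContinuousMap.one_apply]
  refine Finset.sum_subset (Finset.range_subset_range.2 hn) fun i _ hi => ?_
  have hki : k < i := by simpa using hi
  rw [Finset.prod_eq_zero (Finset.mem_range.2 hki) (by simp [hu1 k n x hk])]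
  simp

/-- A pointwise limit of continuous functions takes, up to `ε`, constant rational values on the
members of a countable closed cover. -/
theorem exists_closed_cover_of_pointwiseLimit {X : Type*} [TopologicalSpace X] {g : ℕ → X → ℝ}
    (hg : ∀ n, Continuous (g n)) {f : X → ℝ} (hf : PointwiseLimit g f) {ε : ℝ} (hε : 0 < ε) :
    ∃ (F : ℕ → Set X) (r : ℕ → ℚ), (∀ i, IsClosed (F i)) ∧ (∀ x, ∃ i, x ∈ F i) ∧
      ∀ i, ∀ x ∈ F i, |r i - f x| ≤ ε := by
  obtain ⟨e, he⟩ := exists_surjective_nat (ℕ × ℚ)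
  refine ⟨fun i => {x | ∀ k ≥ (e i).1, |(e i).2 - g k x| ≤ ε}, fun i => (e i).2, ?_, ?_, ?_⟩
  · intro i
    simp only [ofPred_forall]
    exact isClosed_iInter fun k => isClosed_iInter fun _ =>
      isClosed_le ((continuous_const.sub (hg k)).abs) continuous_const
  · intro x
    obtain ⟨q, hq⟩ := exists_rat_btwn (show f x < f x + ε by linarith)
    have hlim : Tendsto (fun k => |(q : ℝ) - g k x|) atTop (𝓝 |(q : ℝ) - f x|) :=
      ((hf x).const_sub _).abs
    have hlt : |(q : ℝ) - f x| < ε := abs_lt.2 ⟨by linarith, by linarith⟩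
    obtain ⟨K, hK⟩ := eventually_atTop.1 (hlim.eventually (eventually_lt_nhds hlt))
    obtain ⟨i, hi⟩ := he (K, q)
    refine ⟨i, fun k hk => ?_⟩
    rw [hi] at hk ⊢
    exact (hK k hk).le
  · intro i x hx
    exact le_of_tendsto ((hf x).const_sub _).abs
      (eventually_atTop.2 ⟨(e i).1, fun k hk => hx k hk⟩)

/-- Pointwise limits of sequences from a set of functions closed under clamping are closed under
uniform limits. -/
theorem exists_seq_tendsto_of_uniform_approx {X : Type*} [TopologicalSpace X] {S : Set C(X, ℝ)}
    (hclamp : ∀ (k : ℕ), ∀ a ∈ S, ∀ b ∈ S,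
      (a - ContinuousMap.const X ((1 / 2 : ℝ) ^ k)) ⊔
        (b ⊓ (a + ContinuousMap.const X ((1 / 2 : ℝ) ^ k))) ∈ S)
    {f : X → ℝ} (happrox : ∀ ε : ℝ, 0 < ε → ∃ s : ℕ → C(X, ℝ), (∀ n, s n ∈ S) ∧
      ∀ x, ∃ y, |y - f x| ≤ ε ∧ Tendsto (fun n => s n x) atTop (𝓝 y)) :
    ∃ s : ℕ → C(X, ℝ), (∀ n, s n ∈ S) ∧ ∀ x, Tendsto (fun n => s n x) atTop (𝓝 (f x)) := by
  choose s hsS h hhf hsh using fun k : ℕ =>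
    happrox ((1 / 2 : ℝ) ^ k / 2) (by positivity)
  let t : ℕ → ℕ → C(X, ℝ) := fun k n => Nat.rec (s 0 n) (fun k a =>
    (a - ContinuousMap.const X ((1 / 2 : ℝ) ^ k)) ⊔
      (s (k + 1) n ⊓ (a + ContinuousMap.const X ((1 / 2 : ℝ) ^ k)))) k
  have htsucc : ∀ k n x, t (k + 1) n x =
      max (t k n x - (1 / 2 : ℝ) ^ k) (min (s (k + 1) n x) (t k n x + (1 / 2 : ℝ) ^ k)) :=
    fun k n x => rfl
  have htS : ∀ k n, t k n ∈ S := fun k n => by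
    induction k with
    | zero => exact hsS 0 n
    | succ k ih => exact hclamp k _ ih _ (hsS (k + 1) n)
  have hth : ∀ k x, Tendsto (fun n => t k n x) atTop (𝓝 (h k x)) := fun k x => by
    induction k with
    | zero => exact hsh 0 x
    | succ k ih =>
      have hlim := (ih.sub_const ((1 / 2 : ℝ) ^ k)).max
        ((hsh (k + 1) x).min (ih.add_const ((1 / 2 : ℝ) ^ k)))
      have h1 := abs_le.1 (hhf k x)
      have h2 := abs_le.1 (hhf (k + 1) x)
      have h3 : (0 : ℝ) < (1 / 2) ^ k := by positivity
      rw [pow_succ] at h2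
      rwa [min_eq_left (by linarith), max_eq_right (by linarith)] at hlim
  have hdist : ∀ k n x, ∀ m ≥ k,
      |t m n x - t k n x| ≤ 2 * (1 / 2 : ℝ) ^ k - 2 * (1 / 2 : ℝ) ^ m := fun k n x m hm => by
    induction m, hm using Nat.le_induction with
    | base => simp
    | succ m _ ih =>
      have hp : (0 : ℝ) < (1 / 2) ^ m := by positivity
      have hstep : |t (m + 1) n x - t m n x| ≤ (1 / 2 : ℝ) ^ m := by
        rw [htsucc, abs_le]
        constructor
        · linarith [le_max_left (t m n x - (1 / 2 : ℝ) ^ m)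
            (min (s (m + 1) n x) (t m n x + (1 / 2 : ℝ) ^ m))]
        · rw [sub_le_iff_le_add]
          exact max_le (by linarith) ((min_le_right _ _).trans (by linarith))
      have := abs_sub_le (t (m + 1) n x) (t m n x) (t k n x)
      rw [pow_succ]
      linarith
  refine ⟨fun n => t n n, fun n => htS n n, fun x => Metric.tendsto_atTop.2 fun ε hε => ?_⟩
  obtain ⟨k, hk⟩ := exists_pow_lt_of_lt_one (show 0 < ε / 4 by positivity)
    (show (1 / 2 : ℝ) < 1 by norm_num)
  obtain ⟨N, hN⟩ := Metric.tendsto_atTop.1 (hth k x) (ε / 4) (by positivity)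
  refine ⟨max N k, fun n hn => ?_⟩
  have h1 := hdist k n x n ((le_max_right _ _).trans hn)
  have h2 := hN n ((le_max_left _ _).trans hn)
  have h3 := hhf k x
  have h4 : (0 : ℝ) < (1 / 2) ^ n := by positivity
  rw [Real.dist_eq] at h2 ⊢
  have h5 := abs_sub_le (t n n x) (t k n x) (f x)
  have h6 := abs_sub_le (t k n x) (h k x) (f x)
  linarith

/-- Every countable set of continuous functions lies in a countable ring of continuous functions
that contains the rational constants and is closed under the lattice operations. -/
theorem exists_countable_subring_lattice {X : Type*} [TopologicalSpace X] {C : Set C(X, ℝ)}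
    (hC : C.Countable) :
    ∃ S : Subring C(X, ℝ), (S : Set C(X, ℝ)).Countable ∧ C ⊆ S ∧
      (∀ q : ℚ, ContinuousMap.const X (q : ℝ) ∈ S) ∧
      ∀ a ∈ S, ∀ b ∈ S, a ⊔ b ∈ S ∧ a ⊓ b ∈ S := by
  let op : Fin 5 → C(X, ℝ) → C(X, ℝ) → C(X, ℝ) :=
    ![(· + ·), (· * ·), (· ⊔ ·), (· ⊓ ·), fun a _ => -a]
  obtain ⟨S, hS, hsub, hop⟩ := (hC.union (countable_range
    fun q : ℚ => ContinuousMap.const X (q : ℝ))).exists_superset_closed op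
  have hq : ∀ q : ℚ, ContinuousMap.const X (q : ℝ) ∈ S :=
    fun q => hsub (Or.inr (mem_range_self q))
  refine ⟨{ carrier := S
            add_mem' := fun {a b} ha hb => hop 0 a ha b hb
            mul_mem' := fun {a b} ha hb => hop 1 a ha b hb
            neg_mem' := fun {a} ha => hop 4 a ha a ha
            zero_mem' := ?_
            one_mem' := ?_ }, hS, subset_union_left.trans hsub, hq,
    fun a ha b hb => ⟨hop 2 a ha b hb, hop 3 a ha b hb⟩⟩
  · convert hq 1
    ext; simp
  · convert hq 0
    ext; simp

/-- For a separable metrizable space `X`, there is a countable set `S` of continuous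
functions with `[S]_seq = B₁(X)`. -/
theorem stmt9 (X : Type u) [TopologicalSpace X] [MetrizableSpace X] [SeparableSpace X] :
    ∃ S : Set (X → ℝ), S.Countable ∧ (∀ f ∈ S, Continuous f) ∧
      ∀ f ∈ B1 X, ∃ g : ℕ → X → ℝ, (∀ n, g n ∈ S) ∧ PointwiseLimit g f := by
  obtain ⟨C, hC, hC01, hsep⟩ := exists_countable_separating_points_closed X
  obtain ⟨S, hS, hCS, hq, hlat⟩ := exists_countable_subring_lattice hC
  refine ⟨(fun s : C(X, ℝ) => (s : X → ℝ)) '' S, hS.image _, ?_, ?_⟩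
  · rintro _ ⟨s, -, rfl⟩
    exact s.continuous
  · rintro f ⟨g, hg, hgf⟩
    obtain ⟨s, hsS, hs⟩ := exists_seq_tendsto_of_uniform_approx (S := (S : Set C(X, ℝ))) (f := f)
      (fun k a ha b hb => by
        have hk : ContinuousMap.const X ((1 / 2 : ℝ) ^ k) ∈ S := by
          simpa using hq ((1 / 2) ^ k)
        exact (hlat _ (S.sub_mem ha hk) _ (hlat _ hb _ (S.add_mem ha hk)).2).1)
      (fun ε hε => by
        obtain ⟨F, r, hF, hcover, hr⟩ := exists_closed_cover_of_pointwiseLimit hg hgf hε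
        obtain ⟨s, hsS, hs⟩ := exists_seq_tendsto_of_cover (S := S) hcover
          (fun i => hq (r i)) fun i => exists_seq_tendsto_indicator_of_isClosed
            (S := S.toSubmonoid) hC hCS hC01 hsep (hF i)
        refine ⟨s, hsS, fun x => ?_⟩
        obtain ⟨i, hi, hlim⟩ := hs x
        exact ⟨r i, hr i x hi, hlim⟩)
    exact ⟨fun n => s n, fun n => mem_image_of_mem _ (hsS n), hs⟩
end

section
/- Let p ∈ βℕ \ ℕ, let Z = ℕ ∪ {p} with the subspace topology from the Stone–Čech compactification βℕ of the discrete space ℕ, and let X = Z^ℕ with the product topology. Then the space USC^f(X), endowed with the topology of pointwise convergence, is NOT sequentially separable. -/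
open Filter Topology Set TopologicalSpace

universe u

theorem IsCozeroSet.isOpen {X : Type u} [TopologicalSpace X] {U : Set X} (hU : IsCozeroSet U) :
    IsOpen U := by
  obtain ⟨g, hg, h⟩ := hU
  rw [← isClosed_compl_iff, h]
  exact isClosed_singleton.preimage hg

theorem IsZeroSet.indicator_one_mem_USCf {X : Type u} [TopologicalSpace X] {F : Set X}
    (hF : IsZeroSet F) : F.indicator (fun _ => (1 : ℝ)) ∈ USCf X := by
  classical
  intro r
  unfold IsCozeroSet
  rcases le_or_gt r 0 with h0 | h0
  · refine ⟨fun _ => 0, continuous_const, ?_⟩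
    ext x
    by_cases hx : x ∈ F <;> simp [hx] <;> linarith
  rcases le_or_gt r 1 with h1 | h1
  · convert hF using 1
    ext x
    by_cases hx : x ∈ F <;> simp [hx] <;> linarith
  · refine ⟨fun _ => 1, continuous_const, ?_⟩
    ext x
    by_cases hx : x ∈ F <;> simp [hx] <;> linarith

/-- A closed box with one and the same clopen side in countably many coordinates is a zero-set. -/
theorem isZeroSet_forall_eq_true {Z : Type u} [TopologicalSpace Z] {h : Z → Bool}
    (hh : Continuous h) : IsZeroSet {x : ℕ → Z | ∀ i, h (x i) = true} := by
  let : MetricSpace (ℕ → Bool) := metrizableSpaceMetric (ℕ → Bool)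
  refine ⟨fun x => dist (fun i => h (x i)) (fun _ => true), ?_, ?_⟩
  · exact Continuous.dist (continuous_pi fun i => hh.comp (continuous_apply i)) continuous_const
  · ext x
    simp [funext_iff]

/-- The point of `ℕ → Z` that starts with the points `u n`, `n ∈ l`, and is constantly `z` after
them. -/
def prefixThenConst {Z : Type u} (u : ℕ → Z) (l : List ℕ) (z : Z) (i : ℕ) : Z :=
  (l[i]?).elim z u

theorem continuous_prefixThenConst {Z : Type u} [TopologicalSpace Z] (u : ℕ → Z) (l : List ℕ) :
    Continuous (prefixThenConst u l) := by
  refine continuous_pi fun i => ?_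
  unfold prefixThenConst
  cases l[i]? with
  | none => exact continuous_id
  | some n => exact continuous_const

/-- A neighbourhood in a countable product of discrete spaces contains a cylinder. -/
theorem exists_cylinder_subset {B : Type*} [TopologicalSpace B] {s : Set (ℕ → B)} {y₀ : ℕ → B}
    (hs : s ∈ 𝓝 y₀) : ∃ j : ℕ, ∀ y : ℕ → B, (∀ i < j, y i = y₀ i) → y ∈ s := by
  obtain ⟨t, hts, ht, hy₀⟩ := mem_nhds_iff.1 hs
  obtain ⟨I, v, hv, hI⟩ := isOpen_pi_iff.1 ht y₀ hy₀
  refine ⟨I.sup id + 1, fun y hy => hts (hI fun i hi => ?_)⟩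
  rw [hy i (Nat.lt_succ_of_le (Finset.le_sup (f := id) hi))]
  exact (hv i hi).2

theorem not_seqSeparable_USCf_pi {Z : Type u} [TopologicalSpace Z] (u : ℕ → Z) (p : Z)
    (H : ∀ V : ℕ → Set Z, (∀ k, V k ∈ 𝓝 p) → ∃ h : Z → Bool, Continuous h ∧ h p = false ∧
      ∀ k, ∃ n, u n ∈ V k ∧ h (u n) = true) :
    ¬ SeqSeparable (USCf (ℕ → Z)) := by
  rintro ⟨S, hSU, hSc, hS⟩
  have hlow : ∀ s ∈ S, IsOpen {x | s x < 1 / 2} := fun s hs => (hSU hs (1 / 2)).isOpen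
  obtain ⟨g₀, hg₀, -⟩ := hS _ (isZeroSet_forall_eq_true
    (continuous_const : Continuous fun _ : Z => true)).indicator_one_mem_USCf
  have : Countable S := hSc.to_subtype
  have : Nonempty S := ⟨⟨_, hg₀ 0⟩⟩
  obtain ⟨e, he⟩ := exists_surjective_nat (S × List ℕ)
  obtain ⟨h, hh, hp, hV⟩ := H
    (fun k => {z | (e k).1.1 (prefixThenConst u (e k).2 p) < 1 / 2 →
      (e k).1.1 (prefixThenConst u (e k).2 z) < 1 / 2}) (by
    intro k
    by_cases hk : (e k).1.1 (prefixThenConst u (e k).2 p) < 1 / 2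
    · exact mem_of_superset (((hlow _ (e k).1.2).preimage
        (continuous_prefixThenConst u (e k).2)).mem_nhds hk) fun z hz _ => hz
    · exact mem_of_superset univ_mem fun z _ h' => absurd h' hk)
  obtain ⟨g, hgS, hg⟩ := hS _ (isZeroSet_forall_eq_true hh).indicator_one_mem_USCf
  let B := {n : ℕ // h (u n) = true}
  have : Nonempty B := (hV 0).elim fun n hn => ⟨⟨n, hn.2⟩⟩
  let E : (ℕ → B) → ℕ → Z := fun y i => u (y i)
  have hE : Continuous E :=
    continuous_pi fun i => (continuous_of_discreteTopology (f := fun b : B => u b)).comp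
      (continuous_apply i)
  have hD : ∀ m, IsClosed {y : ℕ → B | ∀ n ≥ m, 1 / 2 ≤ g n (E y)} := by
    intro m
    simp only [ofPred_forall]
    refine isClosed_iInter fun n => isClosed_iInter fun _ => ?_
    have := ((hlow _ (hgS n)).preimage hE).isClosed_compl
    convert this using 1
    ext y
    simp
  have hU : ⋃ m, {y : ℕ → B | ∀ n ≥ m, 1 / 2 ≤ g n (E y)} = univ := by
    refine eq_univ_of_forall fun y => mem_iUnion.2 ?_
    have hy := hg (E y)
    rw [indicator_of_mem (show E y ∈ {x : ℕ → Z | ∀ i, h (x i) = true} from fun i => (y i).2)]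
      at hy
    exact eventually_atTop.1 (hy.eventually_const_le (by norm_num : (1 / 2 : ℝ) < 1))
  obtain ⟨m, y₀, hy₀⟩ := nonempty_interior_of_iUnion_of_closed hD hU
  obtain ⟨j, hj⟩ := exists_cylinder_subset (mem_interior_iff_mem_nhds.1 hy₀)
  let l : List ℕ := (List.range j).map fun i => (y₀ i : ℕ)
  have hlp : prefixThenConst u l p ∉ {x : ℕ → Z | ∀ i, h (x i) = true} := by
    intro hmem
    have := hmem j
    simp [prefixThenConst, l, hp] at this
  have hlim := hg (prefixThenConst u l p)
  rw [indicator_of_notMem hlp] at hlim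
  obtain ⟨n, hnm, hn⟩ := ((eventually_ge_atTop m).and
    (hlim.eventually_lt_const (by norm_num : (0 : ℝ) < 1 / 2))).exists
  obtain ⟨k, hk⟩ := he (⟨g n, hgS n⟩, l)
  obtain ⟨a, haV, ha⟩ := hV k
  simp only [hk, mem_ofPred_eq] at haV
  have hEy : E (fun i => if i < j then y₀ i else ⟨a, ha⟩) = prefixThenConst u l (u a) := by
    funext i
    by_cases hi : i < j <;> simp [prefixThenConst, l, E, hi]
  have hle := hj (fun i => if i < j then y₀ i else ⟨a, ha⟩) (fun i hi => if_pos hi) n hnm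
  rw [hEy] at hle
  exact (haV hn).not_ge hle

theorem StoneCech.infinite_setOf_stoneCechUnit_mem {α : Type u} [TopologicalSpace α]
    {p : StoneCech α} (hp : p ∉ range (stoneCechUnit : α → StoneCech α)) {W : Set (StoneCech α)}
    (hW : W ∈ 𝓝 p) : {a : α | stoneCechUnit a ∈ W}.Infinite := by
  intro hfin
  have hW' : W ∩ (stoneCechUnit '' {a : α | stoneCechUnit a ∈ W})ᶜ ∈ 𝓝 p :=
    inter_mem hW ((hfin.image _).isClosed.isOpen_compl.mem_nhds
      fun ⟨a, _, ha⟩ => hp ⟨a, ha⟩)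
  obtain ⟨_, ⟨hx, hx'⟩, a, rfl⟩ := mem_closure_iff_nhds.1 (denseRange_stoneCechUnit p) _ hW'
  exact hx' ⟨a, hx, rfl⟩

/-- Countably many neighbourhoods of a point `p ∈ βℕ \ ℕ` are all met by some `B ⊆ ℕ` whose closure
omits `p`. -/
theorem StoneCech.exists_continuous_bool_separating {p : StoneCech ℕ}
    (hp : p ∉ range (stoneCechUnit : ℕ → StoneCech ℕ)) (W : ℕ → Set (StoneCech ℕ))
    (hW : ∀ k, W k ∈ 𝓝 p) : ∃ h : StoneCech ℕ → Bool, Continuous h ∧ h p = false ∧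
      ∀ k, ∃ n, stoneCechUnit n ∈ W k ∧ h (stoneCechUnit n) = true := by
  classical
  obtain ⟨φ, hφ, hφW⟩ := extraction_forall_of_frequently
    (P := fun k n => stoneCechUnit n ∈ W (k / 2)) fun k =>
      Nat.frequently_atTop_iff_infinite.2 (infinite_setOf_stoneCechUnit_mem hp (hW (k / 2)))
  let χ : ℕ → Bool := fun n => decide (∃ k, φ (2 * k) = n)
  have hχ : Continuous χ := continuous_of_discreteTopology
  have hχeven : ∀ k, χ (φ (2 * k)) = true := fun k => by simp [χ, hφ.injective.eq_iff]
  have hχodd : ∀ k, χ (φ (2 * k + 1)) = false := fun k => by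
    simp only [χ, hφ.injective.eq_iff, decide_eq_false_iff_not]
    omega
  cases hb : stoneCechExtend hχ p with
  | false =>
    refine ⟨stoneCechExtend hχ, continuous_stoneCechExtend hχ, hb, fun k => ⟨φ (2 * k), ?_, ?_⟩⟩
    · simpa using hφW (2 * k)
    · rw [stoneCechExtend_stoneCechUnit, hχeven]
  | true =>
    refine ⟨fun z => !stoneCechExtend hχ z,
      (continuous_of_discreteTopology (f := not)).comp (continuous_stoneCechExtend hχ), by simp [hb],
      fun k => ⟨φ (2 * k + 1), ?_, ?_⟩⟩
    · have := hφW (2 * k + 1)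
      rwa [show (2 * k + 1) / 2 = k by omega] at this
    · simp only [stoneCechExtend_stoneCechUnit, hχodd, Bool.not_false]

/-- For `Z = ℕ ∪ {p} ⊆ βℕ` (`p ∈ βℕ \ ℕ`) and `X = Z^ℕ`, the space `USC^f(X)` is not
sequentially separable. -/
theorem stmt10 (p : StoneCech ℕ) (hp : p ∉ Set.range (stoneCechUnit : ℕ → StoneCech ℕ)) :
    ¬ SeqSeparable (USCf (ℕ → ↥(insert p (Set.range (stoneCechUnit : ℕ → StoneCech ℕ))))) := by
  refine not_seqSeparable_USCf_pi (fun n => ⟨stoneCechUnit n, mem_insert_of_mem _ ⟨n, rfl⟩⟩)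
    ⟨p, mem_insert _ _⟩ fun V hV => ?_
  choose W hW hWV using fun k => (mem_nhds_subtype _ _ _).1 (hV k)
  obtain ⟨h, hh, hhp, hn⟩ := StoneCech.exists_continuous_bool_separating hp W hW
  exact ⟨fun z => h z, hh.comp continuous_subtype_val, hhp,
    fun k => (hn k).imp fun n hn => ⟨hWV k hn.1, hn.2⟩⟩
end

section
/- Let p ∈ βℕ \ ℕ, let Z = ℕ ∪ {p} with the subspace topology from the Stone–Čech compactification βℕ of the discrete space ℕ, and let X = Z^ℕ with the product topology. Then C_p(X), the set of continuous real-valued functions on X endowed with the topology of pointwise convergence, is sequentially separable. -/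
open Filter Topology Set TopologicalSpace

universe u

/-- The extension to `βℕ` of the truncation `k ↦ min k n`. -/
noncomputable def stoneCechTruncate (n : ℕ) : StoneCech ℕ → Fin (n + 1) :=
  stoneCechExtend (g := fun k : ℕ => (⟨min k n, by omega⟩ : Fin (n + 1)))
    continuous_of_discreteTopology

theorem continuous_stoneCechTruncate (n : ℕ) : Continuous (stoneCechTruncate n) :=
  continuous_stoneCechExtend _

theorem stoneCechTruncate_unit (n k : ℕ) :
    (stoneCechTruncate n (stoneCechUnit k) : ℕ) = min k n := by
  have h := congrFun (stoneCechExtend_extends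
    (g := fun k : ℕ => (⟨min k n, by omega⟩ : Fin (n + 1))) continuous_of_discreteTopology) k
  exact congrArg Fin.val h

theorem stoneCechTruncate_of_notMem_range (n : ℕ) {p : StoneCech ℕ}
    (hp : p ∉ Set.range (stoneCechUnit : ℕ → StoneCech ℕ)) :
    (stoneCechTruncate n p : ℕ) = n := by
  by_contra hne
  have hlt : (stoneCechTruncate n p : ℕ) < n := by
    have := (stoneCechTruncate n p).isLt
    omega
  have hU : IsOpen (stoneCechTruncate n ⁻¹' {stoneCechTruncate n p} ∩
      {stoneCechUnit (stoneCechTruncate n p : ℕ)}ᶜ) :=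
    ((isOpen_discrete _).preimage (continuous_stoneCechTruncate n)).inter
      isOpen_compl_singleton
  obtain ⟨_, ⟨hx₁, hx₂⟩, k, rfl⟩ := denseRange_stoneCechUnit.inter_open_nonempty _ hU
    ⟨p, rfl, fun h => hp ⟨_, h.symm⟩⟩
  have h := stoneCechTruncate_unit n k
  rw [show stoneCechTruncate n (stoneCechUnit k) = stoneCechTruncate n p from hx₁] at h
  have hk : (stoneCechTruncate n p : ℕ) = k := by omega
  exact hx₂ (by rw [hk]; rfl)

/-- If the identity of `X` is a pointwise limit of maps factoring continuously through finite
discrete spaces, then `C_p(X)` is sequentially separable. -/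
theorem seqSeparable_continuous_of_finite_factorization {X : Type u} [TopologicalSpace X]
    {K : ℕ → Type*} [∀ n, Finite (K n)] [∀ n, TopologicalSpace (K n)]
    [∀ n, DiscreteTopology (K n)] (E : ∀ n, X → K n) (V : ∀ n, K n → X)
    (hE : ∀ n, Continuous (E n))
    (hlim : ∀ x, Tendsto (fun n => V n (E n x)) atTop (𝓝 x)) :
    SeqSeparable {f : X → ℝ | Continuous f} := by
  refine ⟨⋃ n, Set.range fun (q : K n → ℚ) (x : X) => (q (E n x) : ℝ), ?_,
    Set.countable_iUnion fun n => Set.countable_range _, fun f hf => ?_⟩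
  · rintro _ ⟨_, ⟨n, rfl⟩, q, rfl⟩
    exact (continuous_of_discreteTopology (f := fun j => (q j : ℝ))).comp (hE n)
  · have hq (n : ℕ) (j : K n) : ∃ q : ℚ, |f (V n j) - q| < 1 / ((n : ℝ) + 1) :=
      exists_rat_near _ Nat.one_div_pos_of_nat
    choose q hq using hq
    refine ⟨fun n x => q n (E n x), fun n => Set.mem_iUnion.2 ⟨n, q n, rfl⟩, fun x => ?_⟩
    have hdiff : Tendsto (fun n => f (V n (E n x)) - q n (E n x)) atTop (𝓝 0) :=
      squeeze_zero_norm (fun n => (hq n _).le) tendsto_one_div_add_atTop_nhds_zero_nat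
    simpa using ((hf.tendsto x).comp (hlim x)).sub hdiff

/-- For `Z = ℕ ∪ {p} ⊆ βℕ` (`p ∈ βℕ \ ℕ`) and `X = Z^ℕ`, the space `C_p(X)` is
sequentially separable. -/
theorem stmt11 (p : StoneCech ℕ) (hp : p ∉ Set.range (stoneCechUnit : ℕ → StoneCech ℕ)) :
    SeqSeparable {f : (ℕ → ↥(insert p (Set.range (stoneCechUnit : ℕ → StoneCech ℕ)))) → ℝ |
      Continuous f} := by
  let P : ↥(insert p (Set.range (stoneCechUnit : ℕ → StoneCech ℕ))) := ⟨p, Or.inl rfl⟩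
  let v (n : ℕ) (j : Fin (n + 1)) :
      ↥(insert p (Set.range (stoneCechUnit : ℕ → StoneCech ℕ))) :=
    if (j : ℕ) < n then ⟨stoneCechUnit (j : ℕ), Or.inr ⟨j, rfl⟩⟩ else P
  refine seqSeparable_continuous_of_finite_factorization (K := fun n => Fin n → Fin (n + 1))
    (fun n x i => stoneCechTruncate n (x i))
    (fun n j i => if h : i < n then v n (j ⟨i, h⟩) else P)
    (fun n => continuous_pi fun i => (continuous_stoneCechTruncate n).comp
      (continuous_subtype_val.comp (continuous_apply _)))
    (fun x => tendsto_pi_nhds.2 fun i => tendsto_const_nhds.congr' ?_)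
  rcases hx : x i with ⟨_, rfl | ⟨k, rfl⟩⟩
  · filter_upwards [eventually_gt_atTop i] with n hn
    simp [hn, hx, v, P, stoneCechTruncate_of_notMem_range n hp]
  · filter_upwards [eventually_gt_atTop i, eventually_gt_atTop k] with n hn hk
    simp [hn, hx, v, hk, hk.le, stoneCechTruncate_unit]
end

section
/- Let p ∈ βℕ \ ℕ, let Z = ℕ ∪ {p} with the subspace topology from the Stone–Čech compactification βℕ of the discrete space ℕ, and let X = Z^ℕ with the product topology. Then B₁(X), endowed with the topology of pointwise convergence, is sequentially separable. -/
open Filter Topology Set TopologicalSpace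

universe u

section Cylinders

variable {Z : Type*}

/-- The code of the first `n` coordinates of `x`, each truncated at `n`. -/
def truncatedCode (c : Z → ℕ) (n : ℕ) (x : ℕ → Z) : Fin n → Fin (n + 1) :=
  fun i => ⟨min (c (x i)) n, Nat.lt_succ_of_le (min_le_right _ _)⟩

open Classical in
/-- The greatest `j ≤ n` such that the first `j` coordinates of `x` have code less than `n`. -/
noncomputable def codedLength (c : Z → ℕ) (n : ℕ) (x : ℕ → Z) : ℕ :=
  Nat.findGreatest (fun j => ∀ i < j, i < n → c (x i) < n) n

lemma codedLength_le (c : Z → ℕ) (n : ℕ) (x : ℕ → Z) : codedLength c n x ≤ n :=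
  Nat.findGreatest_le n

lemma code_lt_of_lt_codedLength {c : Z → ℕ} {n : ℕ} {x : ℕ → Z} {i : ℕ}
    (hi : i < codedLength c n x) : c (x i) < n := by
  classical
  have h : ∀ i < codedLength c n x, i < n → c (x i) < n :=
    Nat.findGreatest_spec (P := fun j => ∀ i < j, i < n → c (x i) < n) (Nat.zero_le n) (by simp)
  exact h i hi (hi.trans_le (codedLength_le c n x))

lemma tendsto_codedLength (c : Z → ℕ) (x : ℕ → Z) :
    Tendsto (fun n => codedLength c n x) atTop atTop := by
  classical
  refine tendsto_atTop.2 fun j => ?_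
  have h : ∀ᶠ n in atTop, ∀ i ∈ Finset.range j, c (x i) < n :=
    (Filter.eventually_all_finset _).2 fun i _ => eventually_gt_atTop _
  filter_upwards [h, eventually_ge_atTop j] with n hn hj
  exact Nat.le_findGreatest hj fun i hi _ => hn i (Finset.mem_range.2 hi)

lemma code_min_eq {c : Z → ℕ} {n : ℕ} {x y : ℕ → Z}
    (h : truncatedCode c n x = truncatedCode c n y) {i : ℕ} (hi : i < n) :
    min (c (x i)) n = min (c (y i)) n :=
  congrArg Fin.val (congrFun h ⟨i, hi⟩)

lemma codedLength_congr {c : Z → ℕ} {n : ℕ} {x y : ℕ → Z}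
    (h : truncatedCode c n x = truncatedCode c n y) :
    codedLength c n x = codedLength c n y := by
  have : (fun j => ∀ i < j, i < n → c (x i) < n) = fun j => ∀ i < j, i < n → c (y i) < n := by
    funext j
    refine propext (forall_congr' fun i => forall_congr' fun _ => forall_congr' fun hi => ?_)
    have := code_min_eq h hi
    omega
  unfold codedLength
  simp only [this]

lemma eq_of_lt_codedLength {c : Z → ℕ} (hc : Function.Injective c) {n : ℕ} {x y : ℕ → Z}
    (h : truncatedCode c n x = truncatedCode c n y) {i : ℕ} (hi : i < codedLength c n x) :
    x i = y i := by
  have h₁ := code_lt_of_lt_codedLength hi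
  have h₂ := code_min_eq h (hi.trans_le (codedLength_le c n x))
  exact hc (by omega)

variable [TopologicalSpace Z]

lemma exists_cylinder_subset_s12 {U : Set (ℕ → Z)} (hU : IsOpen U) {x : ℕ → Z} (hx : x ∈ U) :
    ∃ m, ∀ y : ℕ → Z, (∀ i < m, y i = x i) → y ∈ U := by
  by_contra! h
  choose y hy hyU using h
  have hlim : Tendsto y atTop (𝓝 x) := by
    refine tendsto_pi_nhds.2 fun i => tendsto_const_nhds.congr' ?_
    filter_upwards [eventually_gt_atTop i] with m hm
    exact (hy m i hm).symm
  obtain ⟨m, hm⟩ := (hlim.eventually (hU.mem_nhds hx)).exists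
  exact hyU m hm

/-- A Baire class one function on `Z ^ ℕ` is the pointwise limit of rational-valued functions, the
`m`-th of which depends only on the first `m` coordinates. -/
lemma exists_rat_approx_of_mem_B1 {f : (ℕ → Z) → ℝ} (hf : f ∈ B1 (ℕ → Z)) :
    ∃ F : ℕ → (ℕ → Z) → ℚ, (∀ m x y, (∀ i < m, x i = y i) → F m x = F m y) ∧
      ∀ x, Tendsto (fun m => (F m x : ℝ)) atTop (𝓝 (f x)) := by
  classical
  obtain ⟨g, hg, hlim⟩ := hf
  let P : ℕ → (ℕ → Z) → ℕ → ℚ → Prop := fun m x k q =>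
    ∀ y : ℕ → Z, (∀ i < m, y i = x i) → dist (q : ℝ) (g k y) < 1 / ((k : ℝ) + 1)
  let K : ℕ → (ℕ → ℚ → Prop) → ℕ := fun m Q => Nat.findGreatest (fun k => ∃ q, Q k q) m
  refine ⟨fun m x => Classical.epsilon (P m x (K m (P m x))), fun m x y hxy => ?_, fun x => ?_⟩
  · have : P m x = P m y := by
      funext k q
      refine propext (forall_congr' fun z => ?_)
      have : (∀ i < m, z i = x i) ↔ ∀ i < m, z i = y i :=
        forall_congr' fun i => forall_congr' fun hi => by rw [hxy i hi]
      rw [this]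
    simp only [this]
  · have key : ∀ k, ∀ᶠ m in atTop, k ≤ K m (P m x) ∧ ∃ q, P m x (K m (P m x)) q := by
      intro k
      obtain ⟨q, hq⟩ := (Rat.denseRange_cast (𝕜 := ℝ)).exists_dist_lt (g k x)
        (Nat.one_div_pos_of_nat (α := ℝ) (n := k))
      have hU : IsOpen {y | dist (q : ℝ) (g k y) < 1 / ((k : ℝ) + 1)} :=
        isOpen_lt (continuous_const.dist (hg k)) continuous_const
      obtain ⟨m₀, hm₀⟩ := exists_cylinder_subset_s12 hU (x := x) (by rwa [dist_comm] at hq)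
      filter_upwards [eventually_ge_atTop m₀, eventually_ge_atTop k] with m hm hkm
      have hk : ∃ q, P m x k q := ⟨q, fun y hy => hm₀ y fun i hi => hy i (hi.trans_le hm)⟩
      exact ⟨Nat.le_findGreatest hkm hk,
        Nat.findGreatest_spec (P := fun k => ∃ q, P m x k q) hkm hk⟩
    have hK : Tendsto (fun m => K m (P m x)) atTop atTop :=
      tendsto_atTop.2 fun k => (key k).mono fun _ h => h.1
    have hgK : Tendsto (fun m => g (K m (P m x)) x) atTop (𝓝 (f x)) := (hlim x).comp hK
    refine (tendsto_iff_of_dist ?_).2 hgK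
    refine squeeze_zero' (Eventually.of_forall fun _ => dist_nonneg) ?_
      (tendsto_one_div_add_atTop_nhds_zero_nat.comp hK)
    filter_upwards [key 0] with m hm
    exact (Classical.epsilon_spec hm.2 x fun _ _ => rfl).le

lemma mem_B1_of_dependsOn_initial {r : ℕ → Z → Z} (hr : ∀ k, IsLocallyConstant (r k))
    (hr' : ∀ z, ∀ᶠ k in atTop, r k z = z) {n : ℕ} {G : (ℕ → Z) → ℝ}
    (hG : ∀ x y, (∀ i < n, x i = y i) → G x = G y) : G ∈ B1 (ℕ → Z) := by
  refine ⟨fun k x => G fun i => r k (x i), fun k => ?_, fun x => ?_⟩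
  · refine continuous_iff_continuousAt.2 fun x => tendsto_const_nhds.congr' ?_
    have h : ∀ᶠ y in 𝓝 x, ∀ i ∈ Finset.range n, r k (y i) = r k (x i) :=
      (Filter.eventually_all_finset _).2 fun i _ =>
        (continuous_apply i).continuousAt.eventually ((hr k).eventually_eq (x i))
    filter_upwards [h] with y hy
    exact hG _ _ fun i hi => (hy i (Finset.mem_range.2 hi)).symm
  · refine tendsto_const_nhds.congr' ?_
    have h : ∀ᶠ k in atTop, ∀ i ∈ Finset.range n, r k (x i) = x i :=
      (Filter.eventually_all_finset _).2 fun i _ => hr' (x i)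
    filter_upwards [h] with k hk
    exact hG _ _ fun i hi => (hk i (Finset.mem_range.2 hi)).symm

theorem seqSeparable_B1_of_retractions {c : Z → ℕ} (hc : Function.Injective c) {r : ℕ → Z → Z}
    (hr : ∀ k, IsLocallyConstant (r k)) (hr' : ∀ z, ∀ᶠ k in atTop, r k z = z) :
    SeqSeparable (B1 (ℕ → Z)) := by
  refine ⟨⋃ n, range fun (h : (Fin n → Fin (n + 1)) → ℚ) (x : ℕ → Z) =>
    (h (truncatedCode c n x) : ℝ), ?_, countable_iUnion fun n => countable_range _, ?_⟩
  · refine iUnion_subset fun n => ?_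
    rintro _ ⟨h, rfl⟩
    refine mem_B1_of_dependsOn_initial hr hr' (n := n) fun x y hxy => ?_
    have : truncatedCode c n x = truncatedCode c n y := by
      funext i
      simp only [truncatedCode, hxy i i.2]
    simp only [this]
  · intro f hf
    obtain ⟨F, hF, hlim⟩ := exists_rat_approx_of_mem_B1 hf
    refine ⟨fun n x => (F (codedLength c n x) x : ℝ), fun n => mem_iUnion.2 ⟨n, ?_⟩,
      fun x => (hlim x).comp (tendsto_codedLength c x)⟩
    have hfac : (fun x => F (codedLength c n x) x).FactorsThrough (truncatedCode c n) := by
      intro x y hxy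
      simp only [← codedLength_congr hxy]
      exact hF _ _ _ fun i hi => eq_of_lt_codedLength hc hxy hi
    exact ⟨Function.extend (truncatedCode c n) (fun x => F (codedLength c n x) x) 0,
      funext fun x => congrArg _ (hfac.extend_apply 0 x)⟩

theorem seqSeparable_B1_of_isOpen_singleton [T1Space Z] [Countable Z] (p : Z)
    (hp : ∀ z, z ≠ p → IsOpen {z}) : SeqSeparable (B1 (ℕ → Z)) := by
  classical
  obtain ⟨c, hc⟩ := exists_injective_nat Z
  refine seqSeparable_B1_of_retractions hc (r := fun k z => if c z < k then z else p)
    (fun k => ?_) fun z => ?_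
  · refine (IsLocallyConstant.iff_exists_open _).2 fun z => ?_
    by_cases hz : z = p
    · subst hz
      refine ⟨({w | c w < k} \ {z})ᶜ, ?_, by simp, fun w hw => ?_⟩
      · exact (((finite_Iio k).preimage hc.injOn).subset sdiff_subset).isClosed.isOpen_compl
      · by_cases h : c w < k
        · have : w = z := by simpa [h] using hw
          simp [this]
        · simp [h]
    · exact ⟨{z}, hp z hz, rfl, fun w hw => by rw [mem_singleton_iff.1 hw]⟩
  · filter_upwards [eventually_gt_atTop (c z)] with k hk
    simp [hk]

end Cylinders

lemma isOpen_singleton_stoneCechUnit {α : Type*} [TopologicalSpace α] [DiscreteTopology α]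
    (a : α) : IsOpen {(stoneCechUnit a : StoneCech α)} := by
  classical
  have hχ : Continuous fun b : α => decide (b = a) := continuous_of_discreteTopology
  have hopen : IsOpen (stoneCechExtend hχ ⁻¹' {true} \ {stoneCechUnit a}) :=
    ((isOpen_discrete _).preimage (continuous_stoneCechExtend hχ)).sdiff isClosed_singleton
  have hempty : stoneCechExtend hχ ⁻¹' {true} \ {stoneCechUnit a} = ∅ := by
    by_contra hne
    obtain ⟨_, ⟨hb, hba⟩, b, rfl⟩ := denseRange_stoneCechUnit.inter_open_nonempty _ hopen
      (nonempty_iff_ne_empty.2 hne)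
    rw [mem_preimage, stoneCechExtend_stoneCechUnit, mem_singleton_iff, decide_eq_true_iff] at hb
    exact hba (by rw [hb]; rfl)
  have hmem : stoneCechUnit a ∈ stoneCechExtend hχ ⁻¹' {true} := by
    simp [stoneCechExtend_stoneCechUnit]
  rw [← (sdiff_eq_empty.1 hempty).antisymm (singleton_subset_iff.2 hmem)]
  exact (isOpen_discrete _).preimage (continuous_stoneCechExtend hχ)

/-- For `Z = ℕ ∪ {p} ⊆ βℕ` (`p ∈ βℕ \ ℕ`) and `X = Z^ℕ`, the space `B₁(X)` is
sequentially separable. -/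
theorem stmt12 (p : StoneCech ℕ) (hp : p ∉ Set.range (stoneCechUnit : ℕ → StoneCech ℕ)) :
    SeqSeparable (B1 (ℕ → ↥(insert p (Set.range (stoneCechUnit : ℕ → StoneCech ℕ))))) := by
  have : Countable ↥(insert p (Set.range (stoneCechUnit : ℕ → StoneCech ℕ))) :=
    ((countable_range _).insert p).to_subtype
  refine seqSeparable_B1_of_isOpen_singleton ⟨p, mem_insert _ _⟩ ?_
  rintro ⟨z, rfl | ⟨n, rfl⟩⟩ hz
  · exact absurd rfl hz
  · convert (isOpen_singleton_stoneCechUnit n).preimage continuous_subtype_val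
    ext w
    simp [Subtype.ext_iff]
end

section
/- Let p ∈ βℕ \ ℕ, let Z = ℕ ∪ {p} with the subspace topology from the Stone–Čech compactification βℕ of the discrete space ℕ, and let X = Z^ℕ with the product topology. Then there exists a continuous surjection from the Baire space ℕ^ℕ (with the product topology, ℕ discrete) onto X. -/
open Filter Topology Set TopologicalSpace

universe u

/-- For `Z = ℕ ∪ {p} ⊆ βℕ` (`p ∈ βℕ \ ℕ`) and `X = Z^ℕ`, there is a continuous surjection
from the Baire space `ℕ^ℕ` onto `X`. -/
theorem stmt13 (p : StoneCech ℕ) (hp : p ∉ Set.range (stoneCechUnit : ℕ → StoneCech ℕ)) :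
    ∃ F : (ℕ → ℕ) → (ℕ → ↥(insert p (Set.range (stoneCechUnit : ℕ → StoneCech ℕ)))),
      Continuous F ∧ Function.Surjective F := by
  have hZ : (insert p (Set.range (stoneCechUnit : ℕ → StoneCech ℕ))).Countable :=
    (Set.countable_range _).insert p
  obtain ⟨e, he⟩ := hZ.exists_surjective (Set.insert_nonempty _ _)
  exact ⟨fun x n => e (x n),
    continuous_pi fun n => continuous_of_discreteTopology.comp (continuous_apply n),
    he.comp_left⟩
end
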